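/- arXiv:math/0405340 — 3 statements merged into one kernel-verified Lean document; each statement's English description precedes it below -/
import Mathlib

section
/- There exists a universal constant K > 0 such that the following holds. Let 𝓖 be a countable class of measurable functions from S into [0,1], X₁,…,Xₙ i.i.d. with law P (n ≥ 3), g₀ ∈ conv(𝓖) a target function, and ĝ_n ∈ argmin_{g ∈ conv(𝓖)} P_n|g − g₀|. Define ψ_n(𝓖, δ) = √(π/(2n)) · inf_{ε>0}( ω(𝓖, ε) + δ·√(N(𝓖, ε)) ), where ω and N are the L²(P_n) continuity modulus and covering numbers, and let r̂_n(𝓖) be the largest solution of r = ψ_n(𝓖, √r). Then for every t > 0, with probability at least 1 − 2e^{−t}: P|ĝ_n − g₀| ≤ K·( r̂_n(𝓖) + (t + log log n)/n ). -/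
open MeasureTheory ProbabilityTheory Real Set

noncomputable section

/-- The `ε`-covering number of `F`: the minimal number of closed balls of radius `ε`
with centers in `F` needed to cover `F`. -/
def coveringNum {E : Type*} [PseudoMetricSpace E] (F : Set E) (ε : ℝ) : ℕ :=
  sInf {n : ℕ | ∃ s : Finset E, ↑s ⊆ F ∧ s.card = n ∧ F ⊆ ⋃ c ∈ s, Metric.closedBall c ε}

/-- The `ε`-entropy of `F`. -/
def entropy {E : Type*} [PseudoMetricSpace E] (F : Set E) (ε : ℝ) : ℝ :=
  Real.log (coveringNum F ε)

/-- `W` is an isonormal Gaussian process on the Hilbert space `H` with respect to the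
probability measure `μ`: every finite linear combination `∑ cᵢ • W (hᵢ)` is a centered
Gaussian random variable with variance `‖∑ cᵢ • hᵢ‖²`; in particular each `W h` is
centered Gaussian and `E[W h * W h'] = ⟪h, h'⟫`. -/
structure IsIsonormal {H : Type*} [NormedAddCommGroup H] [InnerProductSpace ℝ H]
    {Ω : Type*} [MeasurableSpace Ω] (μ : Measure Ω) (W : H → Ω → ℝ) : Prop where
  meas : ∀ h, Measurable (W h)
  gaussian : ∀ (m : ℕ) (h : Fin m → H) (c : Fin m → ℝ),
    μ.map (fun ω => ∑ i, c i * W (h i) ω) = gaussianReal 0 (‖∑ i, c i • h i‖₊ ^ 2)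

/-- The continuity modulus `ω(F, δ)` of the process `W` on the class `F`. -/
def modulus {H : Type*} [NormedAddCommGroup H] [InnerProductSpace ℝ H]
    {Ω : Type*} [MeasurableSpace Ω] (μ : Measure Ω) (W : H → Ω → ℝ)
    (F : Set H) (δ : ℝ) : ℝ :=
  ∫ ω, sSup {a : ℝ | ∃ f ∈ F, ∃ g ∈ F, ‖f - g‖ ≤ δ ∧ a = |W f ω - W g ω|} ∂μ

/-- `A` is a maximal `ε`-separated subset of `F`. -/
def IsMaxSeparated {E : Type*} [PseudoMetricSpace E] (F A : Set E) (ε : ℝ) : Prop :=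
  A ⊆ F ∧ (∀ x ∈ A, ∀ y ∈ A, x ≠ y → ε ≤ dist x y) ∧
    ∀ B : Set E, A ⊆ B → B ⊆ F → (∀ x ∈ B, ∀ y ∈ B, x ≠ y → ε ≤ dist x y) → B = A
/-- The sign `±1` associated to a Boolean coin flip. -/
def radSign (b : Bool) : ℝ := if b then 1 else -1

/-- The law of `n` i.i.d. Rademacher (fair ±1) coin flips. -/
def radMeasure (n : ℕ) : Measure (Fin n → Bool) :=
  Measure.pi fun _ => (PMF.uniformOfFintype Bool).toMeasure

/-- Empirical mean `P_n f = n⁻¹ ∑ f(xᵢ)`. -/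
def empMean {S : Type*} (n : ℕ) (x : Fin n → S) (f : S → ℝ) : ℝ :=
  (∑ i, f (x i)) / n

/-- Rademacher average `R_n f = n⁻¹ ∑ εᵢ f(xᵢ)`. -/
def radAvg {S : Type*} (n : ℕ) (x : Fin n → S) (σ : Fin n → Bool) (f : S → ℝ) : ℝ :=
  (∑ i, radSign (σ i) * f (x i)) / n

/-- `E_ε [ sup { |R_n f| : f ∈ 𝓕, P_n f ≤ u } ]`, the localized Rademacher complexity
(conditionally on the sample `x`). -/
def radSup {S : Type*} (n : ℕ) (𝓕 : Set (S → ℝ)) (x : Fin n → S) (u : ℝ) : ℝ :=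
  ∫ σ, sSup {a : ℝ | ∃ f ∈ 𝓕, empMean n x f ≤ u ∧ a = |radAvg n x σ f|} ∂(radMeasure n)

/-- The natural embedding of a function into `L²(Pₙ)`, realized as the Euclidean space
`ℝⁿ`: `f ↦ (f(x₁)/√n, …, f(xₙ)/√n)`, so that `‖emb f - emb g‖ = (Pₙ (f-g)²)^{1/2}`. -/
def embL2 {S : Type*} (n : ℕ) (x : Fin n → S) (f : S → ℝ) : EuclideanSpace ℝ (Fin n) :=
  (WithLp.equiv 2 (Fin n → ℝ)).symm fun i => f (x i) / Real.sqrt n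

/-- The function `ψₙ(𝓖, δ) = √(π/(2n)) inf_{ε>0} ( ω(𝓖, ε) + δ √(N(𝓖, ε)) )`, where the
modulus and covering numbers are those of the image of `𝓖` in `L²(Pₙ)`. -/
def psiEmp {S : Type*} {Ω : Type*} [MeasurableSpace Ω] (n : ℕ) (μ : Measure Ω)
    (W : EuclideanSpace ℝ (Fin n) → Ω → ℝ) (𝓖 : Set (S → ℝ)) (x : Fin n → S) (δ : ℝ) : ℝ :=
  Real.sqrt (π / (2 * n)) * sInf {a : ℝ | ∃ ε : ℝ, 0 < ε ∧
    a = modulus μ W (embL2 n x '' 𝓖) ε + δ * Real.sqrt (coveringNum (embL2 n x '' 𝓖) ε)}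




/-! ### Property (tau) on the discrete cube -/

lemma cube_scalar {ρ : ℝ} (h0 : 0 < ρ) (h1 : ρ ≤ 1) :
    Real.exp (-ρ * Real.log ρ + (1 - ρ) ^ 2 / 2) * (1 + ρ) ≤ 3 - ρ := by
  have hlog : -ρ * Real.log ρ ≤ (1 - ρ ^ 2) / 2 := by
    have hu : 0 ≤ -Real.log ρ := by
      have := Real.log_nonpos h0.le h1
      linarith
    have := Real.self_le_sinh_iff.mpr hu
    rw [Real.sinh_eq, neg_neg, Real.exp_log h0, Real.exp_neg, Real.exp_log h0] at this
    have h2 := mul_le_mul_of_nonneg_left this h0.le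
    have h3 : ρ * ((ρ⁻¹ - ρ) / 2) = (1 - ρ ^ 2) / 2 := by field_simp
    rw [h3] at h2
    linarith
  have hx : -ρ * Real.log ρ + (1 - ρ) ^ 2 / 2 ≤ 1 - ρ := by nlinarith
  set x := (1 - ρ) / 2 with hxdef
  have hx0 : 0 ≤ x := by simp only [hxdef]; linarith
  have hx1 : x < 1 := by simp only [hxdef]; linarith
  have hs := Real.hasSum_log_sub_log_of_abs_lt_one (x := x) (by rw [abs_of_nonneg hx0]; exact hx1)
  have h4 : 2 * x ≤ Real.log (1 + x) - Real.log (1 - x) := by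
    have := hs.summable.sum_le_tsum (Finset.range 1) (fun i _ => by positivity)
    rw [hs.tsum_eq] at this
    simpa using this
  have h5 : Real.exp (1 - ρ) ≤ (1 + x) / (1 - x) := by
    rw [← Real.log_div (by linarith) (by linarith)] at h4
    have h6 : 1 - ρ = 2 * x := by simp only [hxdef]; ring
    rw [h6, ← Real.exp_log (show 0 < (1 + x) / (1 - x) from div_pos (by linarith) (by linarith))]
    exact Real.exp_le_exp.mpr h4
  calc _ ≤ Real.exp (1 - ρ) * (1 + ρ) := by
        gcongr
    _ ≤ (1 + x) / (1 - x) * (1 + ρ) := by gcongr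
    _ = 3 - ρ := by
        have : (1 - x) ≠ 0 := by linarith
        field_simp
        simp only [hxdef]; ring

lemma cube_step_aux {A B M U1 U2 : ℝ} (hA : 0 < A) (hB : 0 < B) (hBA : B ≤ A)
    {α β : ℝ} (hα : 0 < α) (hβ : 0 < β) (h1 : α * A ≤ M) (h2 : β * B ≤ M)
    (hU1 : ∀ m : ℝ, 0 ≤ m → m ≤ 1 →
      U1 ≤ Real.exp (m * Real.log β + (1 - m) * Real.log α + m ^ 2 / 2))
    (hU2 : ∀ m : ℝ, 0 ≤ m → m ≤ 1 →
      U2 ≤ Real.exp (m * Real.log α + (1 - m) * Real.log β + m ^ 2 / 2)) :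
    (U1 + U2) * (A + B) ≤ 4 * M := by
  have hM : 0 < M := lt_of_lt_of_le (by positivity) h1
  have hu1 : U1 ≤ M / A := by
    have := hU1 0 le_rfl zero_le_one
    simp [Real.exp_log hα] at this
    rw [le_div_iff₀ hA]; nlinarith
  have hρ0 : 0 < B / A := by positivity
  have hρ1 : B / A ≤ 1 := by rw [div_le_one hA]; exact hBA
  have hlα : Real.log α ≤ Real.log M - Real.log A := by
    rw [← Real.log_div hM.ne' hA.ne']
    exact Real.log_le_log hα (by rw [le_div_iff₀ hA]; exact h1)
  have hlβ : Real.log β ≤ Real.log M - Real.log B := by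
    rw [← Real.log_div hM.ne' hB.ne']
    exact Real.log_le_log hβ (by rw [le_div_iff₀ hB]; exact h2)
  set ρ := B / A with hρ
  have hlρ : Real.log ρ = Real.log B - Real.log A := Real.log_div hB.ne' hA.ne'
  have hu2 : U2 ≤ M / A * Real.exp (-ρ * Real.log ρ + (1 - ρ) ^ 2 / 2) := by
    refine (hU2 (1 - ρ) (by linarith) (by linarith)).trans ?_
    rw [← Real.exp_log (show 0 < M / A by positivity), ← Real.exp_add,
      Real.log_div hM.ne' hA.ne']
    apply Real.exp_le_exp.mpr
    rw [hlρ]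
    nlinarith [mul_le_mul_of_nonneg_left hlα (show 0 ≤ 1 - ρ by linarith),
      mul_le_mul_of_nonneg_left hlβ hρ0.le]
  have hs := cube_scalar hρ0 hρ1
  have hB' : B = ρ * A := by rw [hρ]; field_simp
  calc (U1 + U2) * (A + B)
      ≤ (M / A + M / A * Real.exp (-ρ * Real.log ρ + (1 - ρ) ^ 2 / 2)) * (A + B) := by gcongr
    _ = M * ((1 + ρ) + Real.exp (-ρ * Real.log ρ + (1 - ρ) ^ 2 / 2) * (1 + ρ)) := by
        rw [hB']; field_simp
    _ ≤ M * ((1 + ρ) + (3 - ρ)) := by gcongr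
    _ = 4 * M := by ring

lemma cube_step {A B M U1 U2 : ℝ} (hA : 0 < A) (hB : 0 < B)
    {α β : ℝ} (hα : 0 < α) (hβ : 0 < β) (h1 : α * A ≤ M) (h2 : β * B ≤ M)
    (hU1 : ∀ m : ℝ, 0 ≤ m → m ≤ 1 →
      U1 ≤ Real.exp (m * Real.log β + (1 - m) * Real.log α + m ^ 2 / 2))
    (hU2 : ∀ m : ℝ, 0 ≤ m → m ≤ 1 →
      U2 ≤ Real.exp (m * Real.log α + (1 - m) * Real.log β + m ^ 2 / 2)) :
    (U1 + U2) * (A + B) ≤ 4 * M := by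
  rcases le_total B A with h | h
  · exact cube_step_aux hA hB h hα hβ h1 h2 hU1 hU2
  · have := cube_step_aux hB hA h hβ hα h2 h1 hU2 hU1
    linarith

/-- Hoelder's inequality in log-sum-exp form. -/
lemma sum_exp_holder {ι : Type*} [Fintype ι] [Nonempty ι] (p q : ι → ℝ) {m : ℝ} (h0 : 0 ≤ m)
    (h1 : m ≤ 1) :
    ∑ i, Real.exp (m * p i + (1 - m) * q i) ≤
      Real.exp (m * Real.log (∑ i, Real.exp (p i)) + (1 - m) * Real.log (∑ i, Real.exp (q i))) := by
  have hA : 0 < ∑ i, Real.exp (p i) := Finset.sum_pos (fun i _ => Real.exp_pos _) Finset.univ_nonempty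
  have hB : 0 < ∑ i, Real.exp (q i) := Finset.sum_pos (fun i _ => Real.exp_pos _) Finset.univ_nonempty
  set A := ∑ i, Real.exp (p i) with hAd
  set B := ∑ i, Real.exp (q i) with hBd
  have key : ∀ i, Real.exp (m * p i + (1 - m) * q i) ≤
      Real.exp (m * Real.log A + (1 - m) * Real.log B) *
        (m * (Real.exp (p i) / A) + (1 - m) * (Real.exp (q i) / B)) := by
    intro i
    have := Real.geom_mean_le_arith_mean2_weighted (w₁ := m) (w₂ := 1 - m)
      (p₁ := Real.exp (p i) / A) (p₂ := Real.exp (q i) / B) h0 (by linarith) (by positivity)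
      (by positivity) (by ring)
    refine le_trans (le_of_eq ?_) (mul_le_mul_of_nonneg_left this (Real.exp_pos _).le)
    have e1 : Real.exp (p i) / A = Real.exp (p i - Real.log A) := by
      rw [Real.exp_sub, Real.exp_log hA]
    have e2 : Real.exp (q i) / B = Real.exp (q i - Real.log B) := by
      rw [Real.exp_sub, Real.exp_log hB]
    rw [e1, e2, ← Real.exp_mul, ← Real.exp_mul, ← Real.exp_add, ← Real.exp_add]
    congr 1; ring
  refine (Finset.sum_le_sum fun i _ => key i).trans (le_of_eq ?_)
  rw [← Finset.mul_sum, Finset.sum_add_distrib, ← Finset.mul_sum, ← Finset.mul_sum,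
    ← Finset.sum_div, ← Finset.sum_div, ← hAd, ← hBd, div_self hA.ne', div_self hB.ne']
  ring

/-- infimal convolution with the quadratic cost -/
def infConv (n : ℕ) (f : (Fin n → ℝ) → ℝ) (x : Fin n → ℝ) : ℝ :=
  ⨅ y : Fin n → ℝ, f y + (∑ i, (x i - y i) ^ 2) / 8

lemma infConv_le {n : ℕ} {f : (Fin n → ℝ) → ℝ} (hf : ∀ y, 0 ≤ f y) (x y : Fin n → ℝ) :
    infConv n f x ≤ f y + (∑ i, (x i - y i) ^ 2) / 8 :=
  ciInf_le ⟨0, by rintro _ ⟨y, rfl⟩; have := hf y; positivity⟩ y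

lemma le_infConv {n : ℕ} {f : (Fin n → ℝ) → ℝ} (x : Fin n → ℝ) (c : ℝ)
    (h : ∀ y, c ≤ f y + (∑ i, (x i - y i) ^ 2) / 8) : c ≤ infConv n f x :=
  le_ciInf h

/-- the sign vector -/
def sgnVec {n : ℕ} (σ : Fin n → Bool) : Fin n → ℝ := fun i => radSign (σ i)

lemma sum_cube_succ {n : ℕ} (φ : (Fin (n + 1) → Bool) → ℝ) :
    ∑ σ, φ σ = ∑ σ : Fin n → Bool, φ (Fin.cons true σ) + ∑ σ : Fin n → Bool, φ (Fin.cons false σ) := by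
  rw [← (Fin.consEquiv (fun _ => Bool)).sum_comp φ, Fintype.sum_prod_type]
  simp [Fin.consEquiv]

lemma sgnVec_cons {n : ℕ} (b : Bool) (σ : Fin n → Bool) :
    sgnVec (Fin.cons b σ : Fin (n + 1) → Bool) = Fin.cons (radSign b) (sgnVec σ) := by
  funext i
  refine Fin.cases ?_ (fun j => ?_) i <;> simp [sgnVec]

lemma infConv_cons_le {n : ℕ} {f : (Fin (n + 1) → ℝ) → ℝ} (hf : ∀ y, 0 ≤ f y)
    (hc : ConvexOn ℝ univ f) (s s' : ℝ) (hs : (s - s') ^ 2 = 4) (x : Fin n → ℝ) {m : ℝ}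
    (h0 : 0 ≤ m) (h1 : m ≤ 1) :
    infConv (n + 1) f (Fin.cons s x) ≤ m * infConv n (fun y => f (Fin.cons s' y)) x
      + (1 - m) * infConv n (fun y => f (Fin.cons s y)) x + m ^ 2 / 2 := by
  have main : ∀ y y' : Fin n → ℝ, infConv (n + 1) f (Fin.cons s x) ≤
      m * (f (Fin.cons s' y) + (∑ i, (x i - y i) ^ 2) / 8) +
      (1 - m) * (f (Fin.cons s y') + (∑ i, (x i - y' i) ^ 2) / 8) + m ^ 2 / 2 := by
    intro y y'
    refine (infConv_le hf _ (m • (Fin.cons s' y : Fin (n + 1) → ℝ) +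
      (1 - m) • (Fin.cons s y' : Fin (n + 1) → ℝ))).trans ?_
    have hcv := hc.2 (mem_univ (Fin.cons s' y : Fin (n + 1) → ℝ))
      (mem_univ (Fin.cons s y' : Fin (n + 1) → ℝ)) h0 (show 0 ≤ 1 - m by linarith) (by ring)
    simp only [smul_eq_mul] at hcv
    rw [Fin.sum_univ_succ]
    simp only [Pi.add_apply, Pi.smul_apply, Fin.cons_zero, Fin.cons_succ, smul_eq_mul]
    have e1 : (s - (m * s' + (1 - m) * s)) ^ 2 = 4 * m ^ 2 := by
      have : s - (m * s' + (1 - m) * s) = m * (s - s') := by ring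
      rw [this, mul_pow, hs]; ring
    have e2 : ∑ i, (x i - (m * y i + (1 - m) * y' i)) ^ 2 ≤
        m * ∑ i, (x i - y i) ^ 2 + (1 - m) * ∑ i, (x i - y' i) ^ 2 := by
      rw [Finset.mul_sum, Finset.mul_sum, ← Finset.sum_add_distrib]
      refine Finset.sum_le_sum fun i _ => ?_
      nlinarith [mul_nonneg (mul_nonneg h0 (show 0 ≤ 1 - m by linarith)) (sq_nonneg (y i - y' i))]
    rw [e1]
    linarith
  -- take infima
  have step1 : ∀ y' : Fin n → ℝ, infConv (n + 1) f (Fin.cons s x) ≤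
      m * infConv n (fun y => f (Fin.cons s' y)) x +
      (1 - m) * (f (Fin.cons s y') + (∑ i, (x i - y' i) ^ 2) / 8) + m ^ 2 / 2 := by
    intro y'
    unfold infConv
    rw [Real.mul_iInf_of_nonneg h0]
    have : infConv (n + 1) f (Fin.cons s x) -
      (1 - m) * (f (Fin.cons s y') + (∑ i, (x i - y' i) ^ 2) / 8) - m ^ 2 / 2 ≤
      ⨅ y : Fin n → ℝ, m * (f (Fin.cons s' y) + (∑ i, (x i - y i) ^ 2) / 8) := by
      refine le_ciInf fun y => ?_
      have := main y y'
      linarith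
    unfold infConv at this
    linarith
  have : infConv (n + 1) f (Fin.cons s x) -
      m * infConv n (fun y => f (Fin.cons s' y)) x - m ^ 2 / 2 ≤
      (1 - m) * infConv n (fun y => f (Fin.cons s y)) x := by
    conv_rhs => unfold infConv
    rw [Real.mul_iInf_of_nonneg (by linarith)]
    refine le_ciInf fun y => ?_
    have := step1 y
    linarith
  linarith

lemma cube_tau (n : ℕ) : ∀ (f : (Fin n → ℝ) → ℝ), (∀ y, 0 ≤ f y) → ConvexOn ℝ univ f →
    (∑ σ : Fin n → Bool, Real.exp (infConv n f (sgnVec σ))) *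
      (∑ σ : Fin n → Bool, Real.exp (-f (sgnVec σ))) ≤ 4 ^ n := by
  induction n with
  | zero =>
    intro f hf hc
    simp only [Finset.univ_unique, Finset.sum_singleton, pow_zero]
    rw [← Real.exp_add]
    refine Real.exp_le_one_iff.mpr ?_
    generalize sgnVec _ = v
    have := infConv_le hf v v
    simp only [Finset.univ_eq_empty, Finset.sum_empty, zero_div, add_zero] at this
    linarith
  | succ n ih =>
    intro f hf hc
    rw [sum_cube_succ, sum_cube_succ, pow_succ, mul_comm ((4 : ℝ) ^ n) 4]
    simp only [sgnVec_cons]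
    have hconv : ∀ s : ℝ, ConvexOn ℝ univ (fun y : Fin n → ℝ => f (Fin.cons s y)) := by
      intro s
      refine ⟨convex_univ, fun y _ y' _ a b ha hb hab => ?_⟩
      have := hc.2 (mem_univ (Fin.cons s y : Fin (n + 1) → ℝ))
        (mem_univ (Fin.cons s y' : Fin (n + 1) → ℝ)) ha hb hab
      refine le_trans (le_of_eq ?_) this
      refine congrArg f ?_
      funext i
      refine Fin.cases ?_ (fun j => ?_) i
      · simp only [Fin.cons_zero, Pi.add_apply, Pi.smul_apply, smul_eq_mul]
        rw [← add_mul, hab, one_mul]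
      · simp
    have pos : ∀ g : (Fin n → Bool) → ℝ, 0 < ∑ σ, Real.exp (g σ) :=
      fun g => Finset.sum_pos (fun i _ => Real.exp_pos _) Finset.univ_nonempty
    refine cube_step (pos _) (pos _)
      (pos fun σ => infConv n (fun y => f (Fin.cons (radSign true) y)) (sgnVec σ))
      (pos fun σ => infConv n (fun y => f (Fin.cons (radSign false) y)) (sgnVec σ))
      (ih _ (fun y => hf _) (hconv _)) (ih _ (fun y => hf _) (hconv _)) ?_ ?_
    · intro m h0 h1
      rw [Real.exp_add]
      refine le_trans ?_ (mul_le_mul_of_nonneg_right (sum_exp_holder _ _ h0 h1) (Real.exp_pos _).le)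
      rw [Finset.sum_mul]
      refine Finset.sum_le_sum fun σ _ => ?_
      rw [← Real.exp_add]
      exact Real.exp_le_exp.mpr
        (infConv_cons_le hf hc _ _ (by simp [radSign]; norm_num) _ h0 h1)
    · intro m h0 h1
      rw [Real.exp_add]
      refine le_trans ?_ (mul_le_mul_of_nonneg_right (sum_exp_holder _ _ h0 h1) (Real.exp_pos _).le)
      rw [Finset.sum_mul]
      refine Finset.sum_le_sum fun σ _ => ?_
      rw [← Real.exp_add]
      exact Real.exp_le_exp.mpr
        (infConv_cons_le hf hc _ _ (by simp [radSign]; norm_num) _ h0 h1)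

/-- Concentration of convex Lipschitz functions on the cube. -/
lemma cube_conc {n : ℕ} (F : (Fin n → ℝ) → ℝ) (hF : ∀ y, 0 ≤ F y) (hc : ConvexOn ℝ univ F)
    {Q : ℝ} (hQ : 0 < Q)
    (hL : ∀ x y, F x - F y ≤ √(Q * ∑ i, (x i - y i) ^ 2)) {a s : ℝ} (hs : 0 ≤ s) :
    ((Finset.univ.filter fun σ : Fin n → Bool => F (sgnVec σ) ≤ a).card : ℝ) *
      ((Finset.univ.filter fun σ : Fin n → Bool => a + s ≤ F (sgnVec σ)).card : ℝ) ≤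
      4 ^ n * Real.exp (-(s ^ 2 / (8 * Q))) := by
  set l : ℝ := s / (4 * Q) with hl
  have hl0 : 0 ≤ l := by positivity
  have h := cube_tau n (fun y => l * F y) (fun y => mul_nonneg hl0 (hF y)) (by
    simpa using hc.smul hl0)
  have h1 : ((Finset.univ.filter fun σ : Fin n → Bool => F (sgnVec σ) ≤ a).card : ℝ) *
      Real.exp (-(l * a)) ≤ ∑ σ : Fin n → Bool, Real.exp (-(l * F (sgnVec σ))) := by
    rw [← nsmul_eq_mul, ← Finset.sum_const]
    refine (Finset.sum_le_sum (fun σ hσ => ?_)).trans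
      (Finset.sum_le_sum_of_subset_of_nonneg (Finset.filter_subset _ _)
        (fun _ _ _ => (Real.exp_pos _).le))
    rw [Finset.mem_filter] at hσ
    apply Real.exp_le_exp.mpr
    have := mul_le_mul_of_nonneg_left hσ.2 hl0
    linarith
  have h2 : ((Finset.univ.filter fun σ : Fin n → Bool => a + s ≤ F (sgnVec σ)).card : ℝ) *
      Real.exp (l * (a + s) - 2 * l ^ 2 * Q) ≤
      ∑ σ : Fin n → Bool, Real.exp (infConv n (fun y => l * F y) (sgnVec σ)) := by
    rw [← nsmul_eq_mul, ← Finset.sum_const]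
    refine (Finset.sum_le_sum (fun σ hσ => ?_)).trans
      (Finset.sum_le_sum_of_subset_of_nonneg (Finset.filter_subset _ _)
        (fun _ _ _ => (Real.exp_pos _).le))
    rw [Finset.mem_filter] at hσ
    apply Real.exp_le_exp.mpr
    refine le_infConv _ _ fun y => ?_
    have hh := hL (sgnVec σ) y
    set D := ∑ i, (sgnVec σ i - y i) ^ 2 with hD
    have hD0 : 0 ≤ D := Finset.sum_nonneg fun i _ => sq_nonneg _
    rw [Real.sqrt_mul hQ.le] at hh
    have e1 := Real.sq_sqrt hQ.le
    have e2 := Real.sq_sqrt hD0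
    have := mul_le_mul_of_nonneg_left hσ.2 hl0
    have h3 := mul_le_mul_of_nonneg_left hh hl0
    nlinarith [sq_nonneg (4 * l * √Q - √D)]
  have h3 := mul_le_mul h1 h2 (by positivity) (by positivity)
  rw [mul_comm (∑ σ : Fin n → Bool, Real.exp (-(l * F (sgnVec σ))))] at h3
  have h4 := h3.trans h
  have e : -(s ^ 2 / (8 * Q)) = -(-(l * a) + (l * (a + s) - 2 * l ^ 2 * Q)) := by
    rw [hl]; field_simp; ring
  rw [e, Real.exp_neg, ← div_eq_mul_inv, le_div_iff₀ (Real.exp_pos _), Real.exp_add]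
  linarith



/-! ### Rademacher averages of finite families -/

/-- Rademacher complexity (unnormalized) of a finite family of vectors. -/
def radV {ι : Type*} [Fintype ι] {n : ℕ} (v : ι → Fin n → ℝ) : ℝ :=
  (∑ σ : Fin n → Bool, ‖fun h => ∑ i, radSign (σ i) * v h i‖) / 2 ^ n

lemma radSign_not (b : Bool) : radSign (!b) = -radSign b := by cases b <;> simp [radSign]

lemma radSign_sq (b : Bool) : radSign b * radSign b = 1 := by cases b <;> simp [radSign]

lemma abs_radSign (b : Bool) : |radSign b| = 1 := by cases b <;> simp [radSign]

lemma radV_nonneg {ι : Type*} [Fintype ι] {n : ℕ} (v : ι → Fin n → ℝ) : 0 ≤ radV v := by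
  unfold radV; positivity

/-- flipping signs -/
def flipEquiv {n : ℕ} : (Fin n → Bool) ≃ (Fin n → Bool) where
  toFun σ i := !(σ i)
  invFun σ i := !(σ i)
  left_inv σ := by funext i; simp
  right_inv σ := by funext i; simp

/-- multiplying signs -/
def mulSignEquiv {n : ℕ} (τ : Fin n → Bool) : (Fin n → Bool) ≃ (Fin n → Bool) where
  toFun σ i := σ i == τ i
  invFun σ i := σ i == τ i
  left_inv σ := by
    have h : ∀ a b : Bool, ((a == b) == b) = a := by decide
    funext i; exact h _ _
  right_inv σ := by
    have h : ∀ a b : Bool, ((a == b) == b) = a := by decide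
    funext i; exact h _ _

lemma radSign_mulSign (a b : Bool) : radSign (a == b) = radSign a * radSign b := by
  cases a <;> cases b <;> simp [radSign]

lemma bddAbove_fin {ι : Type*} [Finite ι] (f : ι → ℝ) : BddAbove (Set.range f) :=
  (Set.finite_range f).bddAbove

lemma contr_two {ι : Type*} [Finite ι] [Nonempty ι] (A b : ι → ℝ) :
    (⨆ h, (A h + |b h|)) + (⨆ h, (A h - |b h|)) ≤ (⨆ h, (A h + b h)) + (⨆ h, (A h - b h)) := by
  obtain ⟨t, ht⟩ := exists_eq_ciSup_of_finite (f := fun h => A h + |b h|)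
  obtain ⟨s, hs⟩ := exists_eq_ciSup_of_finite (f := fun h => A h - |b h|)
  rw [← ht, ← hs]
  have h1 := le_ciSup (bddAbove_fin fun h => A h + b h) t
  have h2 := le_ciSup (bddAbove_fin fun h => A h + b h) s
  have h3 := le_ciSup (bddAbove_fin fun h => A h - b h) t
  have h4 := le_ciSup (bddAbove_fin fun h => A h - b h) s
  have h5 := abs_sub_abs_le_abs_sub (b t) (b s)
  rcases abs_cases (b t - b s) with h | h <;> linarith

lemma contr_sum {ι : Type*} [Finite ι] [Nonempty ι] (n : ℕ) : ∀ (A : ι → ℝ) (v : ι → Fin n → ℝ),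
    ∑ σ : Fin n → Bool, (⨆ h, (A h + ∑ i, radSign (σ i) * |v h i|)) ≤
    ∑ σ : Fin n → Bool, (⨆ h, (A h + ∑ i, radSign (σ i) * v h i)) := by
  induction n with
  | zero => intro A v; simp
  | succ n ih =>
    intro A v
    rw [sum_cube_succ, sum_cube_succ]
    simp only [Fin.sum_univ_succ, Fin.cons_zero, Fin.cons_succ, ← add_assoc]
    have h1 := ih (fun h => A h + radSign true * v h 0) (fun h i => v h i.succ)
    have h2 := ih (fun h => A h + radSign false * v h 0) (fun h i => v h i.succ)
    refine le_trans ?_ (add_le_add h1 h2)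
    rw [← Finset.sum_add_distrib, ← Finset.sum_add_distrib]
    refine Finset.sum_le_sum fun σ _ => ?_
    have := contr_two (fun h => A h + ∑ i, radSign (σ i) * |v h i.succ|) (fun h => v h 0)
    have e1 : ∀ (c : ι → ℝ) (h : ι), A h + ∑ i, radSign (σ i) * |v h (Fin.succ i)| + c h =
      A h + radSign true * c h + ∑ i, radSign (σ i) * |v h (Fin.succ i)| := by
      intro c h; simp [radSign]; ring
    have e2 : ∀ (c : ι → ℝ) (h : ι), A h + ∑ i, radSign (σ i) * |v h (Fin.succ i)| - c h =
      A h + radSign false * c h + ∑ i, radSign (σ i) * |v h (Fin.succ i)| := by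
      intro c h; simp [radSign]; ring
    simp only [e1 (fun h => |v h 0|), e1 (fun h => v h 0), e2 (fun h => |v h 0|),
      e2 (fun h => v h 0)] at this
    exact this

lemma contr_norm {ι : Type*} [Fintype ι] {n : ℕ} (v : ι → Fin n → ℝ) :
    radV (fun h i => |v h i|) ≤ 2 * radV v := by
  unfold radV
  rw [← mul_div_assoc]
  refine div_le_div_of_nonneg_right ?_ (by positivity)
  let w : Option ι → Fin n → ℝ := fun o => o.elim 0 v
  set S : (Fin n → Bool) → ℝ := fun σ => ⨆ o, (0 + ∑ i, radSign (σ i) * |w o i|) with hS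
  have h1 : ∀ σ : Fin n → Bool, ‖fun h => ∑ i, radSign (σ i) * |v h i|‖ ≤ S σ + S (flipEquiv σ) := by
    intro σ
    have a1 : ∀ σ, 0 ≤ S σ := by
      intro σ
      have := le_ciSup (bddAbove_fin fun o => (0 + ∑ i, radSign (σ i) * |w o i|)) none
      simp only [hS]
      simpa [w] using this
    rw [pi_norm_le_iff_of_nonneg (add_nonneg (a1 _) (a1 _))]
    intro h
    have b1 := le_ciSup (bddAbove_fin fun o => (0 + ∑ i, radSign (σ i) * |w o i|)) (some h)
    have b2 := le_ciSup (bddAbove_fin fun o => (0 + ∑ i, radSign (flipEquiv σ i) * |w o i|)) (some h)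
    have c1 := a1 σ
    have c2 := a1 (flipEquiv σ)
    simp only [hS] at *
    simp only [w, Option.elim, flipEquiv, Equiv.coe_fn_mk, radSign_not, zero_add, neg_mul,
      Finset.sum_neg_distrib] at *
    rw [Real.norm_eq_abs, abs_le]
    constructor <;> linarith
  have h2 : ∑ σ, S σ ≤ ∑ σ : Fin n → Bool, ‖fun h => ∑ i, radSign (σ i) * v h i‖ := by
    refine (contr_sum n (fun _ : Option ι => (0 : ℝ)) w).trans (Finset.sum_le_sum fun σ _ => ?_)
    refine ciSup_le fun o => ?_
    rcases o with _ | h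
    · simp [w]
    · simp only [w, Option.elim, zero_add]
      exact (le_abs_self _).trans (norm_le_pi_norm (fun h => ∑ i, radSign (σ i) * v h i) h)
  calc _ ≤ ∑ σ, (S σ + S (flipEquiv σ)) := Finset.sum_le_sum fun σ _ => h1 σ
    _ = 2 * ∑ σ, S σ := by
        rw [Finset.sum_add_distrib, flipEquiv.sum_comp S]; ring
    _ ≤ _ := by linarith

lemma radV_add_le {ι : Type*} [Fintype ι] {n : ℕ} (v w : ι → Fin n → ℝ) :
    radV (fun h i => v h i + w h i) ≤ radV v + radV w := by
  unfold radV
  rw [← add_div, ← Finset.sum_add_distrib]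
  refine div_le_div_of_nonneg_right (Finset.sum_le_sum fun σ _ => ?_) (by positivity)
  refine le_trans (le_of_eq ?_) (norm_add_le _ _)
  congr 1
  funext h
  simp only [Pi.add_apply, mul_add, Finset.sum_add_distrib]

lemma radV_smul {ι : Type*} [Fintype ι] {n : ℕ} (c : ℝ) (v : ι → Fin n → ℝ) :
    radV (fun h i => c * v h i) = |c| * radV v := by
  unfold radV
  rw [← mul_div_assoc, Finset.mul_sum]
  congr 1
  refine Finset.sum_congr rfl fun σ _ => ?_
  rw [← Real.norm_eq_abs, ← norm_smul]
  congr 1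
  funext h
  simp only [Pi.smul_apply, smul_eq_mul, Finset.mul_sum]
  exact Finset.sum_congr rfl fun i _ => by ring

lemma radV_sign {ι : Type*} [Fintype ι] {n : ℕ} (τ : Fin n → Bool) (v : ι → Fin n → ℝ) :
    radV (fun h i => radSign (τ i) * v h i) = radV v := by
  unfold radV
  congr 1
  rw [← (mulSignEquiv τ).sum_comp (fun σ => ‖fun h => ∑ i, radSign (σ i) * v h i‖)]
  refine Finset.sum_congr rfl fun σ _ => ?_
  congr 1
  funext h
  refine Finset.sum_congr rfl fun i _ => ?_
  simp only [mulSignEquiv, Equiv.coe_fn_mk, radSign_mulSign]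
  ring

/-- selection from a double sample -/
def sel {ι : Type*} {n : ℕ} (σ : Fin n → Bool) (a b : ι → Fin n → ℝ) : ι → Fin n → ℝ :=
  fun h i => if σ i then a h i else b h i

lemma sel_flip {ι : Type*} {n : ℕ} (σ : Fin n → Bool) (a b : ι → Fin n → ℝ) :
    sel (flipEquiv σ) a b = sel σ b a := by
  funext h i
  simp only [sel, flipEquiv, Equiv.coe_fn_mk]
  by_cases hb : σ i = true <;> simp [hb]

lemma radV_le_sel {ι : Type*} [Fintype ι] {n : ℕ} (σ : Fin n → Bool) (a b : ι → Fin n → ℝ) :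
    radV a ≤ radV (sel σ a b) + radV (sel σ b a) := by
  set c := sel σ a b with hc
  set d := sel σ b a with hd
  have e : a = fun h i => (((1 / 2) * c h i + (1 / 2) * d h i) +
      ((1 / 2) * (radSign (σ i) * c h i) + (-1 / 2) * (radSign (σ i) * d h i))) := by
    funext h i
    simp only [hc, hd, sel]
    cases σ i <;> simp [radSign] <;> ring
  have h1 := radV_add_le (fun h i => ((1 / 2) * c h i + (1 / 2) * d h i))
    (fun h i => ((1 / 2) * (radSign (σ i) * c h i) + (-1 / 2) * (radSign (σ i) * d h i)))
  rw [← e] at h1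
  have h2 := radV_add_le (fun h i => (1 / 2) * c h i) (fun h i => (1 / 2) * d h i)
  have h3 := radV_add_le (fun h i => (1 / 2) * (radSign (σ i) * c h i))
    (fun h i => (-1 / 2) * (radSign (σ i) * d h i))
  rw [radV_smul, radV_smul] at h2
  rw [radV_smul (1 / 2) (fun h i => radSign (σ i) * c h i),
    radV_smul (-1 / 2) (fun h i => radSign (σ i) * d h i), radV_sign, radV_sign] at h3
  have e1 : |(1 / 2 : ℝ)| = 1 / 2 := abs_of_pos (by norm_num)
  have e2 : |(-1 / 2 : ℝ)| = 1 / 2 := by rw [abs_of_neg (by norm_num)]; norm_num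
  rw [e1] at h2 h3
  rw [e2] at h3
  linarith

lemma affNorm_convex {ι : Type*} [Fintype ι] {n : ℕ} (d : ι → ℝ) (c : ι → Fin n → ℝ) :
    ConvexOn ℝ univ (fun s : Fin n → ℝ => ‖fun h => d h + ∑ i, s i * c h i‖) := by
  refine ⟨convex_univ, fun x _ y _ p q hp hq hpq => ?_⟩
  have e : (fun h => d h + ∑ i, (p • x + q • y) i * c h i) =
      p • (fun h => d h + ∑ i, x i * c h i) + q • (fun h => d h + ∑ i, y i * c h i) := by
    funext h
    simp only [Pi.add_apply, Pi.smul_apply, smul_eq_mul, mul_add, Finset.mul_sum, add_mul,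
      Finset.sum_add_distrib]
    have : d h = p * d h + q * d h := by rw [← add_mul, hpq, one_mul]
    conv_lhs => rw [this]
    simp only [mul_assoc]
    ring
  simp only [e]
  refine (norm_add_le _ _).trans ?_
  rw [norm_smul, norm_smul, Real.norm_of_nonneg hp, Real.norm_of_nonneg hq]
  simp

lemma affNorm_lip {ι : Type*} [Fintype ι] {n : ℕ} (d : ι → ℝ) (c : ι → Fin n → ℝ) {Q : ℝ}
    (hc : ∀ h, ∑ i, c h i ^ 2 ≤ Q) (x y : Fin n → ℝ) :
    ‖fun h => d h + ∑ i, x i * c h i‖ - ‖fun h => d h + ∑ i, y i * c h i‖ ≤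
      √(Q * ∑ i, (x i - y i) ^ 2) := by
  refine (norm_sub_norm_le _ _).trans ?_
  rw [pi_norm_le_iff_of_nonneg (Real.sqrt_nonneg _)]
  intro h
  rw [Real.norm_eq_abs]
  apply Real.abs_le_sqrt
  have e : ((fun h => d h + ∑ i, x i * c h i) - (fun h => d h + ∑ i, y i * c h i)) h =
      ∑ i, c h i * (x i - y i) := by
    simp only [Pi.sub_apply]
    rw [add_sub_add_left_eq_sub, ← Finset.sum_sub_distrib]
    exact Finset.sum_congr rfl fun i _ => by ring
  rw [e]
  refine (Finset.sum_mul_sq_le_sq_mul_sq _ _ _).trans ?_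
  exact mul_le_mul_of_nonneg_right (hc h) (Finset.sum_nonneg fun i _ => sq_nonneg _)

lemma half_conc {n : ℕ} {p q E : ℝ} (hp : 2 ^ n / 2 ≤ p) (hq : 0 ≤ q)
    (h : p * q ≤ 4 ^ n * E) : q ≤ 2 ^ n * (2 * E) := by
  have h4 : (4 : ℝ) ^ n = 2 ^ n * 2 ^ n := by rw [← mul_pow]; norm_num
  rw [h4] at h
  have h1 : 2 ^ n / 2 * q ≤ 2 ^ n * 2 ^ n * E := (mul_le_mul_of_nonneg_right hp hq).trans h
  have h2 : (0 : ℝ) < 2 ^ n := by positivity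
  have h3 : 2 ^ n * (q / 2) ≤ 2 ^ n * (2 ^ n * E) := by linarith
  have := le_of_mul_le_mul_left h3 h2
  linarith

lemma card_split {n : ℕ} (p : (Fin n → Bool) → Prop) [DecidablePred p] :
    ((Finset.univ.filter p).card : ℝ) + ((Finset.univ.filter fun σ => ¬ p σ).card : ℝ) = 2 ^ n := by
  have := Finset.card_filter_add_card_filter_not (s := (Finset.univ : Finset (Fin n → Bool))) p
  rw [Finset.card_univ] at this
  have e : Fintype.card (Fin n → Bool) = 2 ^ n := by simp
  rw [e] at this
  exact_mod_cast this

open Classical in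
/-- The conditional (double sample) estimate. -/
lemma cube_claim {ι : Type*} [Fintype ι] {n : ℕ} (a b : ι → Fin n → ℝ)
    (ha : ∀ h i, |a h i| ≤ 1) (hb : ∀ h i, |b h i| ≤ 1) {R : ℝ} (hR : 0 < R)
    (hsum : ∀ h, ∑ i, |a h i| + ∑ i, |b h i| ≤ 5 * R) :
    ((Finset.univ.filter fun σ : Fin n → Bool =>
      (∃ h, ∑ i, |sel σ a b h i| ≤ R / 8 ∧ R / 4 ≤ ∑ i, |sel σ b a h i|) ∧
        radV (sel σ a b) < R / 512).card : ℝ) ≤ 2 ^ n * (2 * Real.exp (-(R / 5242880))) := by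
  set F : (Fin n → ℝ) → ℝ := fun s => ‖fun h => 0 + ∑ i, s i * (|b h i| - |a h i|)‖ with hF
  have hFV : radV (fun h i => |b h i| - |a h i|) = (∑ σ, F (sgnVec σ)) / 2 ^ n := by
    unfold radV
    simp only [hF, sgnVec, zero_add]
  have h2n : (0 : ℝ) < 2 ^ n := by positivity
  by_cases hcase : radV (fun h i => |b h i| - |a h i|) ≤ R / 32
  · -- small complexity
    have hQ : ∀ h, ∑ i, (|b h i| - |a h i|) ^ 2 ≤ 5 * R := by
      intro h
      refine le_trans ?_ (hsum h)
      rw [← Finset.sum_add_distrib]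
      refine Finset.sum_le_sum fun i _ => ?_
      have h1 := ha h i
      have h2 := hb h i
      have h3 := abs_nonneg (a h i)
      have h4 := abs_nonneg (b h i)
      nlinarith
    have hconc := cube_conc F (fun y => norm_nonneg _) (affNorm_convex _ _)
      (Q := 5 * R) (by positivity) (affNorm_lip _ _ hQ) (a := R / 16) (s := R / 16) (by positivity)
    have hmark : (2 : ℝ) ^ n / 2 ≤
        ((Finset.univ.filter fun σ : Fin n → Bool => F (sgnVec σ) ≤ R / 16).card : ℝ) := by
      have hs := card_split (n := n) (fun σ => F (sgnVec σ) ≤ R / 16)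
      have : ((Finset.univ.filter fun σ : Fin n → Bool => ¬ F (sgnVec σ) ≤ R / 16).card : ℝ)
          * (R / 16) ≤ ∑ σ, F (sgnVec σ) := by
        rw [← nsmul_eq_mul, ← Finset.sum_const]
        refine (Finset.sum_le_sum (fun σ hσ => ?_)).trans
          (Finset.sum_le_sum_of_subset_of_nonneg (Finset.filter_subset _ _)
            (fun _ _ _ => norm_nonneg _))
        rw [Finset.mem_filter] at hσ
        exact (not_le.mp hσ.2).le
      rw [hFV, div_le_iff₀ h2n] at hcase
      have h3 : ((Finset.univ.filter fun σ : Fin n → Bool => ¬ F (sgnVec σ) ≤ R / 16).card : ℝ)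
        ≤ 2 ^ n / 2 := by
        have : ((Finset.univ.filter fun σ : Fin n → Bool => ¬ F (sgnVec σ) ≤ R / 16).card : ℝ)
          * (R / 16) ≤ 2 ^ n / 2 * (R / 16) := by linarith
        exact le_of_mul_le_mul_right this (by positivity)
      linarith
    have hfin := half_conc hmark (by positivity) hconc
    have hexp : Real.exp (-((R / 16) ^ 2 / (8 * (5 * R)))) ≤ Real.exp (-(R / 5242880)) := by
      apply Real.exp_le_exp.mpr
      have : (R / 16) ^ 2 / (8 * (5 * R)) = R / 10240 := by field_simp; norm_num
      rw [this]; linarith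
    refine le_trans ?_ (hfin.trans (by gcongr))
    norm_cast
    apply Finset.card_le_card
    intro σ hσ
    simp only [Finset.mem_filter, Finset.mem_univ, true_and] at hσ ⊢
    obtain ⟨⟨h, h1, h2⟩, -⟩ := hσ
    have e : ∑ i, |sel σ b a h i| - ∑ i, |sel σ a b h i| =
        0 + ∑ i, sgnVec σ i * (|b h i| - |a h i|) := by
      rw [← Finset.sum_sub_distrib, zero_add]
      refine Finset.sum_congr rfl fun i _ => ?_
      simp only [sel, sgnVec]
      cases σ i <;> simp [radSign]
    have := norm_le_pi_norm (fun h => 0 + ∑ i, sgnVec σ i * (|b h i| - |a h i|)) h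
    rw [Real.norm_eq_abs] at this
    have h5 := le_abs_self (0 + ∑ i, sgnVec σ i * (|b h i| - |a h i|))
    simp only [hF]
    linarith
  · -- large complexity
    push Not at hcase
    have hab : R / 64 < radV a + radV b := by
      have h1 := radV_add_le (fun h i => |b h i|) (fun h i => (-1) * |a h i|)
      rw [radV_smul (-1) (fun h i => |a h i|)] at h1
      have h2 := contr_norm a
      have h3 := contr_norm b
      have e : (fun h i => |b h i| + (-1) * |a h i|) = (fun h i => |b h i| - |a h i|) := by
        funext h i; ring
      rw [e] at h1
      simp at h1
      linarith
    have hsel : ∀ σ : Fin n → Bool, R / 128 < radV (sel σ a b) + radV (sel (flipEquiv σ) a b) := by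
      intro σ
      rw [sel_flip]
      have h1 := radV_le_sel σ a b
      have h2 := radV_le_sel σ b a
      linarith
    set V : (Fin n → ℝ) → ℝ := fun s => (1 / 2 ^ n) * ∑ ε : Fin n → Bool,
      ‖fun h => (∑ i, radSign (ε i) * ((a h i + b h i) / 2)) +
        ∑ i, s i * (radSign (ε i) * ((a h i - b h i) / 2))‖ with hV
    have hVsel : ∀ σ, V (sgnVec σ) = radV (sel σ a b) := by
      intro σ
      simp only [hV, radV]
      rw [one_div, mul_comm, ← div_eq_mul_inv]
      congr 1
      refine Finset.sum_congr rfl fun ε _ => ?_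
      congr 1
      funext h
      rw [← Finset.sum_add_distrib]
      refine Finset.sum_congr rfl fun i _ => ?_
      simp only [sgnVec, sel]
      have ht : radSign true = 1 := rfl
      have hf : radSign false = -1 := rfl
      cases hb : σ i
      · rw [hf]; simp only [Bool.false_eq_true, if_false]; ring
      · rw [ht]; simp only [if_true]; ring
    have hV0 : ∀ y, 0 ≤ V y := fun y => by simp only [hV]; positivity
    have hVc : ConvexOn ℝ univ V := by
      have h1 : ConvexOn ℝ univ (fun s : Fin n → ℝ => ∑ ε : Fin n → Bool,
        ‖fun h => (∑ i, radSign (ε i) * ((a h i + b h i) / 2)) +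
        ∑ i, s i * (radSign (ε i) * ((a h i - b h i) / 2))‖) := by
        refine ⟨convex_univ, fun x hx y hy p q hp hq hpq => ?_⟩
        simp only [smul_eq_mul]
        rw [Finset.mul_sum, Finset.mul_sum, ← Finset.sum_add_distrib]
        refine Finset.sum_le_sum fun ε _ => ?_
        have := (affNorm_convex (fun h => ∑ i, radSign (ε i) * ((a h i + b h i) / 2))
          (fun h i => radSign (ε i) * ((a h i - b h i) / 2))).2 hx hy hp hq hpq
        simpa only [smul_eq_mul] using this
      have := h1.smul (c := 1 / 2 ^ n) (by positivity)
      simpa only [smul_eq_mul] using this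
    have hQ : ∀ ε : Fin n → Bool, ∀ h,
        ∑ i, (radSign (ε i) * ((a h i - b h i) / 2)) ^ 2 ≤ 5 * R / 2 := by
      intro ε h
      have : ∑ i, (radSign (ε i) * ((a h i - b h i) / 2)) ^ 2 ≤
        ∑ i, (|a h i| + |b h i|) / 2 := by
        refine Finset.sum_le_sum fun i _ => ?_
        have e : (radSign (ε i) * ((a h i - b h i) / 2)) ^ 2 = |a h i - b h i| ^ 2 / 4 := by
          rw [mul_pow, sq (radSign _), radSign_sq, sq_abs]; ring
        rw [e]
        have h1 := ha h i
        have h2 := hb h i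
        have h3 := abs_sub (a h i) (b h i)
        have h4 := abs_nonneg (a h i - b h i)
        nlinarith
      refine this.trans ?_
      rw [← Finset.sum_div, Finset.sum_add_distrib]
      have := hsum h
      linarith
    have hVL : ∀ x y, V x - V y ≤ √(5 * R / 2 * ∑ i, (x i - y i) ^ 2) := by
      intro x y
      simp only [hV]
      rw [← mul_sub, ← Finset.sum_sub_distrib]
      have : ∑ ε : Fin n → Bool, (‖fun h => (∑ i, radSign (ε i) * ((a h i + b h i) / 2)) +
          ∑ i, x i * (radSign (ε i) * ((a h i - b h i) / 2))‖ -
          ‖fun h => (∑ i, radSign (ε i) * ((a h i + b h i) / 2)) +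
          ∑ i, y i * (radSign (ε i) * ((a h i - b h i) / 2))‖) ≤
          ∑ ε : Fin n → Bool, √(5 * R / 2 * ∑ i, (x i - y i) ^ 2) :=
        Finset.sum_le_sum fun ε _ => affNorm_lip _ _ (hQ ε) x y
      rw [Finset.sum_const, Finset.card_univ] at this
      have e : Fintype.card (Fin n → Bool) = 2 ^ n := by simp
      rw [e, nsmul_eq_mul] at this
      push_cast at this
      rw [one_div, inv_mul_le_iff₀ h2n]
      exact this
    have hconc := cube_conc V hV0 hVc (Q := 5 * R / 2) (by positivity) hVL
      (a := R / 512) (s := R / 512) (by positivity)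
    have hhalf : (2 : ℝ) ^ n / 2 ≤
        ((Finset.univ.filter fun σ : Fin n → Bool => R / 512 + R / 512 ≤ V (sgnVec σ)).card : ℝ) := by
      have hs := card_split (n := n) (fun σ => R / 512 + R / 512 ≤ V (sgnVec σ))
      have : (Finset.univ.filter fun σ : Fin n → Bool => ¬ R / 512 + R / 512 ≤ V (sgnVec σ)).card ≤
        (Finset.univ.filter fun σ : Fin n → Bool => R / 512 + R / 512 ≤ V (sgnVec σ)).card := by
        refine Finset.card_le_card_of_injOn flipEquiv ?_ flipEquiv.injective.injOn
        intro σ hσ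
        simp only [Finset.coe_filter, Finset.mem_univ, true_and, mem_ofPred_eq, hVsel, not_le] at hσ ⊢
        have := hsel σ
        linarith
      have : ((Finset.univ.filter fun σ : Fin n → Bool => ¬ R / 512 + R / 512 ≤ V (sgnVec σ)).card : ℝ) ≤
        ((Finset.univ.filter fun σ : Fin n → Bool => R / 512 + R / 512 ≤ V (sgnVec σ)).card : ℝ) := by
        exact_mod_cast this
      linarith
    rw [mul_comm] at hconc
    have hfin := half_conc hhalf (by positivity) hconc
    have hexp : Real.exp (-((R / 512) ^ 2 / (8 * (5 * R / 2)))) = Real.exp (-(R / 5242880)) := by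
      congr 2
      field_simp; norm_num
    rw [hexp] at hfin
    refine le_trans ?_ hfin
    norm_cast
    apply Finset.card_le_card
    intro σ hσ
    simp only [Finset.mem_filter, Finset.mem_univ, true_and] at hσ ⊢
    rw [hVsel]
    exact hσ.2.le



/-! ### Symmetrization by double sampling -/

/-- no large Rademacher complexity among functions with small empirical norm -/
def lowRad {S : Type*} {n : ℕ} (T : Finset (S → ℝ)) (R : ℝ) (x : Fin n → S) : Prop :=
  ∀ T' ∈ T.powerset, (∀ h ∈ T', ∑ i, |h (x i)| ≤ 5 * R) →
    radV (fun (h : T') i => (h : S → ℝ) (x i)) < R / 512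

/-- a bad pair of samples -/
def badPair {S : Type*} {n : ℕ} (T : Finset (S → ℝ)) (R : ℝ) (x y : Fin n → S) : Prop :=
  (∃ h ∈ T, ∑ i, |h (x i)| ≤ R / 8 ∧ R / 4 ≤ ∑ i, |h (y i)| ∧ ∑ i, |h (y i)| ≤ 4 * R) ∧
    lowRad T R x

lemma cheb {S : Type*} [MeasurableSpace S] (P : Measure S) [IsProbabilityMeasure P] {n : ℕ}
    {h : S → ℝ} (hm : Measurable h) (hb : ∀ s, |h s| ≤ 1) {R : ℝ} (hR : 64 ≤ R)
    (h1 : R / 2 ≤ n * ∫ s, |h s| ∂P) (h2 : n * ∫ s, |h s| ∂P ≤ 2 * R) :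
    (1 / 2 : ENNReal) ≤ (Measure.pi fun _ : Fin n => P)
      {y | R / 4 ≤ ∑ i, |h (y i)| ∧ ∑ i, |h (y i)| ≤ 4 * R} := by
  have hmem : MemLp (fun s => |h s|) 2 P :=
    MemLp.of_bound (by fun_prop) 1 (by filter_upwards with s; simpa using hb s)
  set Y : (Fin n → S) → ℝ := ∑ i, fun y => |h (y i)| with hY
  have hYa : ∀ y, Y y = ∑ i, |h (y i)| := by intro y; simp [hY]
  have hvar : Var[Y; Measure.pi fun _ : Fin n => P] ≤ n * ∫ s, |h s| ∂P := by
    rw [hY, variance_sum_pi (μ := fun _ : Fin n => P) (X := fun _ s => |h s|) (fun _ => hmem)]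
    simp only [Finset.sum_const, Finset.card_univ, Fintype.card_fin, nsmul_eq_mul]
    refine mul_le_mul_of_nonneg_left ?_ (by positivity)
    refine (variance_le_expectation_sq (by fun_prop)).trans ?_
    refine integral_mono (hmem.integrable_sq) (hmem.integrable (by norm_num)) ?_
    intro s
    simp only [Pi.pow_apply]
    nlinarith [abs_nonneg (h s), hb s]
  have hmemY : MemLp Y 2 (Measure.pi fun _ : Fin n => P) := by
    rw [hY]
    exact memLp_finsetSum' _ fun i _ =>
      hmem.comp_measurePreserving (measurePreserving_eval (fun _ : Fin n => P) i)
  have hmean : ∫ y, Y y ∂(Measure.pi fun _ : Fin n => P) = n * ∫ s, |h s| ∂P := by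
    simp only [hYa]
    rw [integral_finsetSum]
    · have : ∀ i : Fin n, ∫ y, |h (y i)| ∂(Measure.pi fun _ : Fin n => P) = ∫ s, |h s| ∂P := by
        intro i
        exact integral_comp_eval (μ := fun _ : Fin n => P) (f := fun s => |h s|) (by fun_prop)
      simp [this]
    · intro i _
      exact (hmem.comp_measurePreserving (measurePreserving_eval (fun _ : Fin n => P) i)).integrable
        (by norm_num)
  have hch := meas_ge_le_variance_div_sq hmemY (c := R / 4) (by linarith)
  rw [hmean] at hch
  have hle : (Measure.pi fun _ : Fin n => P)
      {y | R / 4 ≤ |Y y - n * ∫ s, |h s| ∂P|} ≤ 1 / 2 := by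
    refine hch.trans ?_
    rw [show (1 / 2 : ENNReal) = ENNReal.ofReal (1 / 2) by
      rw [ENNReal.ofReal_div_of_pos (by norm_num)]; simp]
    refine ENNReal.ofReal_le_ofReal ?_
    rw [div_le_iff₀ (by positivity)]
    nlinarith
  have hcov : (univ : Set (Fin n → S)) ⊆ {y | R / 4 ≤ ∑ i, |h (y i)| ∧ ∑ i, |h (y i)| ≤ 4 * R} ∪
      {y | R / 4 ≤ |Y y - n * ∫ s, |h s| ∂P|} := by
    intro y _
    by_cases hy : R / 4 ≤ |Y y - n * ∫ s, |h s| ∂P|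
    · exact Or.inr hy
    · left
      push Not at hy
      rw [abs_lt, hYa] at hy
      exact ⟨by linarith [hy.1], by linarith [hy.2]⟩
  have h3 := (measure_mono hcov).trans (measure_union_le (μ := Measure.pi fun _ : Fin n => P) _ _)
  rw [measure_univ] at h3
  have h4 := h3.trans (add_le_add_right hle _)
  have h5 : (1 : ENNReal) / 2 + 1 / 2 = 1 := by
    rw [one_div]; exact ENNReal.inv_two_add_inv_two
  have h6 : (1 : ENNReal) / 2 + 1 / 2 ≤ (Measure.pi fun _ : Fin n => P)
      {y | R / 4 ≤ ∑ i, |h (y i)| ∧ ∑ i, |h (y i)| ≤ 4 * R} + 1 / 2 := h5.le.trans h4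
  exact (ENNReal.add_le_add_iff_right (a := 1 / 2) (by simp)).1 h6

lemma measurableSet_lowRad {S : Type*} [MeasurableSpace S] {n : ℕ} (T : Finset (S → ℝ)) (R : ℝ)
    (hm : ∀ h ∈ T, Measurable h) : MeasurableSet {x : Fin n → S | lowRad T R x} := by
  unfold lowRad
  have e : {x : Fin n → S | ∀ T' ∈ T.powerset, (∀ h ∈ T', ∑ i, |h (x i)| ≤ 5 * R) →
    radV (fun (h : T') i => (h : S → ℝ) (x i)) < R / 512} =
    ⋂ T' ∈ T.powerset, ({x | ∀ h ∈ T', ∑ i, |h (x i)| ≤ 5 * R}ᶜ ∪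
      {x | radV (fun (h : T') i => (h : S → ℝ) (x i)) < R / 512}) := by
    ext x
    simp only [Set.mem_iInter, Set.mem_union, Set.mem_compl_iff, Set.mem_ofPred_eq]
    refine forall₂_congr fun T' _ => ?_
    exact imp_iff_not_or
  rw [e]
  refine Finset.measurableSet_biInter _ fun T' hT' => ?_
  have hm' : ∀ h ∈ T', Measurable h := fun h hh => hm h (Finset.mem_powerset.1 hT' hh)
  refine (MeasurableSet.compl ?_).union ?_
  · have e2 : {x : Fin n → S | ∀ h ∈ T', ∑ i, |h (x i)| ≤ 5 * R} =
        ⋂ h ∈ T', {x | ∑ i, |h (x i)| ≤ 5 * R} := by ext x; simp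
    rw [e2]
    refine Finset.measurableSet_biInter _ fun h hh => ?_
    have := hm' h hh
    exact measurableSet_le (by fun_prop) measurable_const
  · refine measurableSet_lt ?_ measurable_const
    unfold radV
    refine Measurable.div_const ?_ _
    refine Finset.measurable_sum _ fun σ _ => ?_
    refine Measurable.norm ?_
    refine measurable_pi_lambda _ fun h => ?_
    have := hm' h h.2
    fun_prop

lemma measurableSet_badPair {S : Type*} [MeasurableSpace S] {n : ℕ} (T : Finset (S → ℝ)) (R : ℝ)
    (hm : ∀ h ∈ T, Measurable h) :
    MeasurableSet {z : (Fin n → S) × (Fin n → S) | badPair T R z.1 z.2} := by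
  have e : {z : (Fin n → S) × (Fin n → S) | badPair T R z.1 z.2} =
      (⋃ h ∈ T, ({z : (Fin n → S) × (Fin n → S) | ∑ i, |h (z.1 i)| ≤ R / 8} ∩
        ({z : (Fin n → S) × (Fin n → S) | R / 4 ≤ ∑ i, |h (z.2 i)|} ∩
        {z : (Fin n → S) × (Fin n → S) | ∑ i, |h (z.2 i)| ≤ 4 * R}))) ∩ Prod.fst ⁻¹' {x | lowRad T R x} := by
    ext z
    simp only [badPair, Set.mem_inter_iff, Set.mem_iUnion, Set.mem_ofPred_eq, Set.mem_preimage,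
      exists_prop]
  rw [e]
  refine MeasurableSet.inter (Finset.measurableSet_biUnion _ fun h hh => ?_)
    (measurable_fst (measurableSet_lowRad T R hm))
  have := hm h hh
  refine MeasurableSet.inter ?_ (MeasurableSet.inter ?_ ?_)
  · exact measurableSet_le (by fun_prop) measurable_const
  · exact measurableSet_le measurable_const (by fun_prop)
  · exact measurableSet_le (by fun_prop) measurable_const

/-- swap of the coordinates where `σ` is false -/
def swapBy {S : Type*} {n : ℕ} (σ : Fin n → Bool) (z : Fin n → S × S) : Fin n → S × S :=
  fun i => if σ i then z i else (z i).swap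

lemma measurePreserving_swapBy {S : Type*} [MeasurableSpace S] (P : Measure S)
    [IsProbabilityMeasure P] {n : ℕ} (σ : Fin n → Bool) :
    MeasurePreserving (swapBy (S := S) σ) (Measure.pi fun _ : Fin n => P.prod P)
      (Measure.pi fun _ : Fin n => P.prod P) := by
  refine measurePreserving_pi (fun _ : Fin n => P.prod P) (fun _ : Fin n => P.prod P)
    (f := fun i p => if σ i then p else p.swap) fun i => ?_
  cases hb : σ i
  · simpa using Measure.measurePreserving_swap (μ := P) (ν := P)
  · simp only [if_true]
    exact MeasurePreserving.id (P.prod P)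

lemma pointwise_count {S : Type*} {n : ℕ} (T : Finset (S → ℝ)) {R : ℝ} (hR : 0 < R)
    (hb : ∀ h ∈ T, ∀ s, |h s| ≤ 1) (z : Fin n → S × S)
    [DecidablePred fun σ : Fin n → Bool =>
      badPair T R (fun i => (swapBy σ z i).1) (fun i => (swapBy σ z i).2)] :
    ((Finset.univ.filter fun σ : Fin n → Bool =>
      badPair T R (fun i => (swapBy σ z i).1) (fun i => (swapBy σ z i).2)).card : ℝ) ≤
      2 ^ n * (2 * Real.exp (-(R / 5242880))) := by
  classical
  set Tz : Finset (S → ℝ) := T.filter fun h => ∑ i, |h (z i).1| + ∑ i, |h (z i).2| ≤ 5 * R with hTz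
  let a : Tz → Fin n → ℝ := fun h i => (h : S → ℝ) (z i).1
  let b : Tz → Fin n → ℝ := fun h i => (h : S → ℝ) (z i).2
  have hTzT : Tz ⊆ T := Finset.filter_subset _ _
  have key := cube_claim a b (fun h i => hb h (hTzT h.2) _) (fun h i => hb h (hTzT h.2) _) hR
    (fun h => (Finset.mem_filter.1 h.2).2)
  refine le_trans ?_ key
  norm_cast
  refine Finset.card_le_card fun σ hσ => ?_
  simp only [Finset.mem_filter, Finset.mem_univ, true_and] at hσ ⊢
  obtain ⟨⟨h, hT, h1, h2, h3⟩, hl⟩ := hσ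
  have s1 : ∀ (h : S → ℝ) i, h (swapBy σ z i).1 = if σ i then h (z i).1 else h (z i).2 := by
    intro h i; unfold swapBy; by_cases hb : σ i = true <;> simp [hb]
  have s2 : ∀ (h : S → ℝ) i, h (swapBy σ z i).2 = if σ i then h (z i).2 else h (z i).1 := by
    intro h i; unfold swapBy; by_cases hb : σ i = true <;> simp [hb]
  have s3 : ∀ h : S → ℝ, ∑ i, |h (swapBy σ z i).1| + ∑ i, |h (swapBy σ z i).2| =
      ∑ i, |h (z i).1| + ∑ i, |h (z i).2| := by
    intro h
    rw [← Finset.sum_add_distrib, ← Finset.sum_add_distrib]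
    refine Finset.sum_congr rfl fun i _ => ?_
    rw [s1 h i, s2 h i]
    by_cases hb : σ i = true <;> simp [hb, add_comm]
  have s4 : ∀ h : S → ℝ, 0 ≤ ∑ i, |h (swapBy σ z i).2| := fun h =>
    Finset.sum_nonneg fun i _ => abs_nonneg _
  refine ⟨⟨⟨h, ?_⟩, ?_, ?_⟩, ?_⟩
  · rw [hTz, Finset.mem_filter]
    refine ⟨hT, ?_⟩
    rw [← s3]; linarith
  · simpa [sel, a, b, s1] using h1
  · simpa [sel, a, b, s2] using h2
  · have := hl Tz (Finset.mem_powerset.2 hTzT) (by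
      intro h hh
      have h5 := (Finset.mem_filter.1 hh).2
      rw [← s3] at h5
      linarith [s4 h])
    have e : (fun (h : Tz) i => (h : S → ℝ) (swapBy σ z i).1) = sel σ a b := by
      funext h i; simp [sel, a, b, s1]
    rwa [e] at this

lemma badPair_measure {S : Type*} [MeasurableSpace S] (P : Measure S) [IsProbabilityMeasure P]
    {n : ℕ} (T : Finset (S → ℝ)) {R : ℝ} (hR : 0 < R) (hm : ∀ h ∈ T, Measurable h)
    (hb : ∀ h ∈ T, ∀ s, |h s| ≤ 1) :
    ((Measure.pi fun _ : Fin n => P).prod (Measure.pi fun _ : Fin n => P))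
      {z | badPair T R z.1 z.2} ≤ ENNReal.ofReal (2 * Real.exp (-(R / 5242880))) := by
  classical
  have mp := measurePreserving_arrowProdEquivProdArrow S S (Fin n) (fun _ => P) (fun _ => P)
  have hD := measurableSet_badPair (n := n) T R hm
  rw [← mp.measure_preimage hD.nullMeasurableSet]
  set ν := Measure.pi fun _ : Fin n => P.prod P with hν
  set D : Set (Fin n → S × S) := (MeasurableEquiv.arrowProdEquivProdArrow S S (Fin n)) ⁻¹'
    {z | badPair T R z.1 z.2} with hDD
  have hDm : MeasurableSet D := mp.measurable hD
  have hmemD : ∀ z, z ∈ D ↔ badPair T R (fun i => (z i).1) (fun i => (z i).2) := fun z => Iff.rfl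
  have h1 : ∀ σ : Fin n → Bool, ν D = ∫⁻ z, (D.indicator 1 (swapBy σ z)) ∂ν := by
    intro σ
    rw [(measurePreserving_swapBy P σ).lintegral_comp (measurable_one.indicator hDm),
      lintegral_indicator_one hDm]
  have h2 : (2 ^ n : ENNReal) * ν D = ∫⁻ z, ∑ σ : Fin n → Bool, (D.indicator 1 (swapBy σ z)) ∂ν := by
    rw [lintegral_finsetSum (f := fun σ z => D.indicator 1 (swapBy σ z)) _ fun σ _ =>
      (measurable_one.indicator hDm).comp (measurePreserving_swapBy P σ).measurable]
    simp only [← h1]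
    simp
  have h3 : ∀ z, ∑ σ : Fin n → Bool, (D.indicator (1 : (Fin n → S × S) → ENNReal) (swapBy σ z)) ≤
      2 ^ n * ENNReal.ofReal (2 * Real.exp (-(R / 5242880))) := by
    intro z
    have := pointwise_count T hR hb z
    have e : ∑ σ : Fin n → Bool, (D.indicator (1 : (Fin n → S × S) → ENNReal) (swapBy σ z)) =
      ((Finset.univ.filter fun σ : Fin n → Bool =>
      badPair T R (fun i => (swapBy σ z i).1) (fun i => (swapBy σ z i).2)).card : ENNReal) := by
      rw [Finset.card_filter]
      push_cast
      refine Finset.sum_congr rfl fun σ _ => ?_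
      rw [Set.indicator_apply]
      simp only [hmemD, Pi.one_apply]
    rw [e]
    have h5 := ENNReal.ofReal_le_ofReal this
    rw [ENNReal.ofReal_mul (by positivity)] at h5
    simpa [ENNReal.ofReal_pow] using h5
  have h4 : (2 ^ n : ENNReal) * ν D ≤ 2 ^ n * ENNReal.ofReal (2 * Real.exp (-(R / 5242880))) := by
    rw [h2]
    refine (lintegral_mono h3).trans ?_
    simp [hν]
  exact (ENNReal.mul_le_mul_iff_right (by simp) (by simp)).1 h4

/-- Double-sampling bound. -/
lemma double_sampling {S : Type*} [MeasurableSpace S] (P : Measure S) [IsProbabilityMeasure P]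
    {n : ℕ} (T : Finset (S → ℝ)) {R : ℝ} (hR : 64 ≤ R) (hm : ∀ h ∈ T, Measurable h)
    (hb : ∀ h ∈ T, ∀ s, |h s| ≤ 1) :
    (Measure.pi fun _ : Fin n => P) {x | (∃ h ∈ T, R / 2 ≤ n * ∫ s, |h s| ∂P ∧
      n * ∫ s, |h s| ∂P ≤ 2 * R ∧ ∑ i, |h (x i)| ≤ R / 8) ∧ lowRad T R x} ≤
      ENNReal.ofReal (4 * Real.exp (-(R / 5242880))) := by
  have hD := measurableSet_badPair (n := n) T R hm
  set D : Set ((Fin n → S) × (Fin n → S)) := {z | badPair T R z.1 z.2} with hDD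
  have h0 := badPair_measure P (n := n) T (by linarith) hm hb
  rw [← hDD, Measure.prod_apply hD] at h0
  have h1 := mul_meas_ge_le_lintegral (μ := Measure.pi fun _ : Fin n => P)
    (measurable_measure_prodMk_left (ν := Measure.pi fun _ : Fin n => P) hD) (1 / 2)
  have h2 := h1.trans h0
  have h3 : (Measure.pi fun _ : Fin n => P) {x | (∃ h ∈ T, R / 2 ≤ n * ∫ s, |h s| ∂P ∧
      n * ∫ s, |h s| ∂P ≤ 2 * R ∧ ∑ i, |h (x i)| ≤ R / 8) ∧ lowRad T R x} ≤
      (Measure.pi fun _ : Fin n => P)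
        {x | (1 / 2 : ENNReal) ≤ (Measure.pi fun _ : Fin n => P) (Prod.mk x ⁻¹' D)} := by
    refine measure_mono ?_
    rintro x ⟨⟨h, hT, h1, h2, h3⟩, hl⟩
    refine (cheb P (hm h hT) (hb h hT) hR h1 h2).trans (measure_mono ?_)
    rintro y ⟨hy1, hy2⟩
    exact ⟨⟨h, hT, h3, hy1, hy2⟩, hl⟩
  refine h3.trans ?_
  have h4 := mul_le_mul_right h2 (2 : ENNReal)
  rw [← mul_assoc, show (2 : ENNReal) * (1 / 2) = 1 by
    rw [one_div]; exact ENNReal.mul_inv_cancel (by simp) (by simp), one_mul] at h4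
  refine h4.trans (le_of_eq ?_)
  rw [show (4 : ℝ) * Real.exp (-(R / 5242880)) = 2 * (2 * Real.exp (-(R / 5242880))) by ring,
    ENNReal.ofReal_mul (by norm_num : (0:ℝ) ≤ 2)]
  simp



/-! ### Gaussian suprema -/

section gaussianSup
variable {E : Type*} [NormedAddCommGroup E] [InnerProductSpace ℝ E]

/-- local oscillation of the linear form `y` over `A` -/
def qs (A : Set E) (ε : ℝ) (y : E) : ℝ :=
  sSup {a : ℝ | ∃ f ∈ A, ∃ g ∈ A, ‖f - g‖ ≤ ε ∧ a = |inner ℝ f y - inner ℝ g y|}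

lemma qs_nonneg (A : Set E) (ε : ℝ) (y : E) : 0 ≤ qs A ε y := by
  refine Real.sSup_nonneg ?_
  rintro a ⟨f, -, g, -, -, rfl⟩
  exact abs_nonneg _

lemma qs_elem_le {ε : ℝ} {f g : E} (h : ‖f - g‖ ≤ ε) (y : E) :
    |inner ℝ f y - inner ℝ g y| ≤ ε * ‖y‖ := by
  rw [← inner_sub_left]
  exact (abs_real_inner_le_norm _ _).trans (mul_le_mul_of_nonneg_right h (norm_nonneg _))

lemma le_qs {A : Set E} {ε : ℝ} {f g : E} (hf : f ∈ A) (hg : g ∈ A) (h : ‖f - g‖ ≤ ε) (y : E) :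
    |inner ℝ f y - inner ℝ g y| ≤ qs A ε y := by
  refine le_csSup ⟨ε * ‖y‖, ?_⟩ ⟨f, hf, g, hg, h, rfl⟩
  rintro a ⟨f, -, g, -, h, rfl⟩
  exact qs_elem_le h y

lemma qs_le {A : Set E} {ε : ℝ} (hε : 0 ≤ ε) (y : E) : qs A ε y ≤ ε * ‖y‖ := by
  refine Real.sSup_le ?_ (by positivity)
  rintro a ⟨f, -, g, -, h, rfl⟩
  exact qs_elem_le h y

lemma qs_add_le (A : Set E) (ε : ℝ) (y z : E) : qs A ε (y + z) ≤ qs A ε y + qs A ε z := by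
  refine Real.sSup_le ?_ (add_nonneg (qs_nonneg _ _ _) (qs_nonneg _ _ _))
  rintro a ⟨f, hf, g, hg, h, rfl⟩
  rw [inner_add_right, inner_add_right, add_sub_add_comm]
  exact (abs_add_le _ _).trans (add_le_add (le_qs hf hg h y) (le_qs hf hg h z))

lemma qs_smul_le (A : Set E) (ε : ℝ) (c : ℝ) (y : E) : qs A ε (c • y) ≤ |c| * qs A ε y := by
  refine Real.sSup_le ?_ (mul_nonneg (abs_nonneg _) (qs_nonneg _ _ _))
  rintro a ⟨f, hf, g, hg, h, rfl⟩
  rw [inner_smul_right, inner_smul_right, ← mul_sub, abs_mul]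
  exact mul_le_mul_of_nonneg_left (le_qs hf hg h y) (abs_nonneg _)

lemma qs_continuous (A : Set E) {ε : ℝ} (hε : 0 ≤ ε) : Continuous (qs A ε) := by
  refine LipschitzWith.continuous (K := ⟨ε, hε⟩) (LipschitzWith.of_le_add_mul _ fun x y => ?_)
  have h1 := qs_add_le A ε y (x - y)
  rw [add_sub_cancel] at h1
  rw [dist_eq_norm]
  exact h1.trans (add_le_add_right (qs_le hε _) _)

variable [FiniteDimensional ℝ E] [MeasurableSpace E] [BorelSpace E]

lemma qs_integrable (A : Set E) {ε : ℝ} (hε : 0 ≤ ε) : Integrable (qs A ε) (stdGaussian E) := by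
  have h1 : Integrable (fun y : E => ε * ‖y‖) (stdGaussian E) :=
    (IsGaussian.integrable_id (μ := stdGaussian E)).norm.const_mul ε
  refine h1.mono' (qs_continuous A hε).aestronglyMeasurable ?_
  filter_upwards with y
  rw [Real.norm_of_nonneg (qs_nonneg _ _ _)]
  exact qs_le hε y

lemma integral_comp_isom (f : E ≃ₗᵢ[ℝ] E) (φ : E → ℝ) :
    ∫ y, φ (f y) ∂(stdGaussian E) = ∫ y, φ y ∂(stdGaussian E) := by
  have h := stdGaussian_map (E := E) f
  conv_rhs => rw [← h]
  exact (f.toHomeomorph.toMeasurableEquiv.measurableEmbedding.integral_map φ).symm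

lemma integral_norm_proj (L : Submodule ℝ E) :
    ∫ y, ‖L.starProjection y‖ ∂(stdGaussian E) ≤ √(Module.finrank ℝ L) := by
  have hmem : MemLp (fun y : E => ‖L.starProjection y‖) 2 (stdGaussian E) := by
    have h1 : MemLp (fun y : E => y) 2 (stdGaussian E) := IsGaussian.memLp_id _ 2 (by simp)
    refine h1.norm.mono (by fun_prop) ?_
    filter_upwards with y
    simpa using L.norm_starProjection_apply_le y
  have hvar := variance_nonneg (fun y : E => ‖L.starProjection y‖) (stdGaussian E)
  rw [variance_eq_sub hmem] at hvar
  refine Real.le_sqrt_of_sq_le ?_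
  have hsq : ∫ y, ‖L.starProjection y‖ ^ 2 ∂(stdGaussian E) = Module.finrank ℝ L := by
    set b := stdOrthonormalBasis ℝ L
    have e : ∀ y : E, ‖L.starProjection y‖ ^ 2 = ∑ j, (inner ℝ (b j : E) y) ^ 2 := by
      intro y
      have h1 := b.sum_sq_inner_right (L.orthogonalProjectionOnto y)
      have h2 : ‖L.starProjection y‖ = ‖L.orthogonalProjectionOnto y‖ := rfl
      rw [h2, ← h1]
      refine Finset.sum_congr rfl fun j _ => ?_
      congr 1
      rw [Submodule.inner_orthogonalProjectionOnto_eq_of_mem_left]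
    have hi : ∀ v : E, Integrable (fun y => (inner ℝ v y) ^ 2) (stdGaussian E) := fun v =>
      (IsGaussian.memLp_dual (stdGaussian E) (innerSL ℝ v) 2 (by simp)).integrable_sq
    have hv : ∀ v : E, ∫ y, (inner ℝ v y) ^ 2 ∂(stdGaussian E) = ‖v‖ ^ 2 := by
      intro v
      have h1 := variance_dual_stdGaussian (innerSL ℝ v)
      rw [variance_eq_sub (IsGaussian.memLp_dual (stdGaussian E) (innerSL ℝ v) 2 (by simp)),
        integral_strongDual_stdGaussian] at h1
      simpa using h1
    simp only [e]
    rw [integral_finsetSum _ fun j _ => hi _]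
    simp only [hv]
    have : ∀ j, ‖(b j : E)‖ = 1 := fun j => b.norm_eq_one j
    simp [this]
  simp only [Pi.pow_apply] at hvar
  rw [hsq] at hvar
  linarith

set_option linter.unusedSectionVars false in
lemma abs_inner_le_qs_of_hull {A : Set E} {ε : ℝ} {s : Finset E} (hs : (s : Set E) ⊆ A)
    (hcov : A ⊆ ⋃ c ∈ s, Metric.closedBall c ε) {z : E} (hz : ∀ c ∈ s, inner ℝ c z = 0) {a : E}
    (ha : a ∈ convexHull ℝ A) : |inner ℝ a z| ≤ qs A ε z := by
  have hconv : Convex ℝ {a : E | |inner ℝ a z| ≤ qs A ε z} := by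
    intro u hu v hv α β hα hβ hαβ
    simp only [Set.mem_ofPred_eq] at hu hv ⊢
    rw [inner_add_left, inner_smul_left, inner_smul_left]
    simp only [conj_trivial]
    refine (abs_add_le _ _).trans ?_
    rw [abs_mul, abs_mul, abs_of_nonneg hα, abs_of_nonneg hβ]
    calc α * |inner ℝ u z| + β * |inner ℝ v z| ≤ α * qs A ε z + β * qs A ε z := by gcongr
      _ = qs A ε z := by rw [← add_mul, hαβ, one_mul]
  refine convexHull_min ?_ hconv ha
  intro a ha
  obtain ⟨c, hc, hac⟩ := Set.mem_iUnion₂.1 (hcov ha)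
  have := le_qs ha (hs hc) (by simpa [dist_eq_norm] using hac) z
  rwa [hz c hc, sub_zero] at this

/-- Expected supremum over a subset of the difference of convex hulls. -/
lemma hull_bound {A : Set E} (hA : Bornology.IsBounded A) {ε : ℝ} (hε : 0 < ε)
    {ι : Type*} [Fintype ι] (u : ι → E) {δ : ℝ} (hδ : 0 ≤ δ)
    (hu : ∀ h, ∃ a ∈ convexHull ℝ A, ∃ b ∈ convexHull ℝ A, u h = a - b) (hun : ∀ h, ‖u h‖ ≤ δ) :
    ∫ y, ‖fun h => (inner ℝ (u h) y : ℝ)‖ ∂(stdGaussian E) ≤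
      2 * ∫ y, qs A ε y ∂(stdGaussian E) + δ * √(coveringNum A ε) := by
  have hne : {n : ℕ | ∃ s : Finset E, ↑s ⊆ A ∧ s.card = n ∧
      A ⊆ ⋃ c ∈ s, Metric.closedBall c ε}.Nonempty := by
    obtain ⟨t, htA, htf, htc⟩ := Metric.finite_approx_of_totallyBounded
      ((Bornology.IsBounded.isCompact_closure hA).totallyBounded.subset subset_closure) ε hε
    refine ⟨_, htf.toFinset, by simpa using htA, rfl, htc.trans ?_⟩
    refine Set.iUnion₂_mono' fun c hc => ⟨c, by simpa using hc, Metric.ball_subset_closedBall⟩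
  obtain ⟨s, hsA, hcard, hcov⟩ := Nat.sInf_mem hne
  have hcard' : s.card = coveringNum A ε := hcard
  set L : Submodule ℝ E := Submodule.span ℝ (s : Set E) with hL
  have hfr : Module.finrank ℝ L ≤ coveringNum A ε := by
    rw [← hcard']; exact finrank_span_finset_le_card s
  have hpt : ∀ y, ‖fun h => (inner ℝ (u h) y : ℝ)‖ ≤
      δ * ‖L.starProjection y‖ + (qs A ε y + qs A ε (L.reflection y)) := by
    intro y
    have hnn : 0 ≤ δ * ‖L.starProjection y‖ + (qs A ε y + qs A ε (L.reflection y)) :=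
      add_nonneg (by positivity) (add_nonneg (qs_nonneg _ _ _) (qs_nonneg _ _ _))
    rw [pi_norm_le_iff_of_nonneg hnn]
    intro h
    rw [Real.norm_eq_abs]
    set z := y - L.starProjection y with hz
    have hzL : ∀ c ∈ s, inner ℝ c z = 0 := fun c hc =>
      L.inner_right_of_mem_orthogonal (Submodule.subset_span hc)
        (Submodule.sub_starProjection_mem_orthogonal (K := L) y)
    have hqz : 2 * qs A ε z ≤ qs A ε y + qs A ε (L.reflection y) := by
      have e : z = (1 / 2 : ℝ) • y + (-1 / 2 : ℝ) • L.reflection y := by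
        rw [hz, L.reflection_apply]
        module
      have h1 := qs_add_le A ε ((1 / 2 : ℝ) • y) ((-1 / 2 : ℝ) • L.reflection y)
      have h2 := qs_smul_le A ε (1 / 2) y
      have h3 := qs_smul_le A ε (-1 / 2) (L.reflection y)
      rw [← e] at h1
      rw [show |(1 : ℝ) / 2| = 1 / 2 by norm_num [abs_div]] at h2
      rw [show |(-1 : ℝ) / 2| = 1 / 2 by norm_num [abs_div]] at h3
      linarith
    obtain ⟨a, ha, b, hb, hab⟩ := hu h
    have h1 := abs_inner_le_qs_of_hull hsA hcov hzL ha
    have h2 := abs_inner_le_qs_of_hull hsA hcov hzL hb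
    have h3 : |inner ℝ (u h) (L.starProjection y)| ≤ δ * ‖L.starProjection y‖ :=
      (abs_real_inner_le_norm _ _).trans (mul_le_mul_of_nonneg_right (hun h) (norm_nonneg _))
    have e : inner ℝ (u h) y = inner ℝ (u h) (L.starProjection y) + (inner ℝ a z - inner ℝ b z) := by
      rw [← inner_sub_left, ← hab, ← inner_add_right, hz, add_sub_cancel]
    rw [e]
    have h4 := abs_sub (inner ℝ a z) (inner ℝ b z)
    have h5 := abs_add_le (inner ℝ (u h) (L.starProjection y)) (inner ℝ a z - inner ℝ b z)
    linarith
  have hnorm : Integrable (fun y : E => ‖L.starProjection y‖) (stdGaussian E) := by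
    have h1 : Integrable (fun y : E => y) (stdGaussian E) := IsGaussian.integrable_id
    exact (L.starProjection.integrable_comp h1).norm
  have hq := qs_integrable A (ε := ε) hε.le
  have hq2 : Integrable (fun y => qs A ε (L.reflection y)) (stdGaussian E) := by
    have h := stdGaussian_map (E := E) L.reflection
    have h2 := hq
    rw [← h] at h2
    exact (L.reflection.toHomeomorph.toMeasurableEquiv.measurableEmbedding.integrable_map_iff).1 h2
  calc ∫ y, ‖fun h => (inner ℝ (u h) y : ℝ)‖ ∂(stdGaussian E)
      ≤ ∫ y, (δ * ‖L.starProjection y‖ + (qs A ε y + qs A ε (L.reflection y))) ∂(stdGaussian E) := by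
        refine integral_mono_of_nonneg ?_ ?_ ?_
        · filter_upwards with y; exact norm_nonneg _
        · exact (hnorm.const_mul δ).add (hq.add hq2)
        · filter_upwards with y; exact hpt y
    _ = δ * ∫ y, ‖L.starProjection y‖ ∂(stdGaussian E) +
        (∫ y, qs A ε y ∂(stdGaussian E) + ∫ y, qs A ε y ∂(stdGaussian E)) := by
        have h1 := integral_add (hnorm.const_mul δ) (hq.add hq2)
        simp only [Pi.add_apply] at h1
        rw [h1, integral_const_mul, integral_add hq hq2, integral_comp_isom L.reflection (qs A ε)]
    _ ≤ _ := by
        have h1 := (integral_norm_proj L).trans (Real.sqrt_le_sqrt (Nat.cast_le.2 hfr))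
        have h2 := mul_le_mul_of_nonneg_left h1 hδ
        linarith

end gaussianSup

/-- first absolute moment of the standard Gaussian -/
def kap : ℝ := ∫ x, |x| ∂(gaussianReal 0 1)

lemma kap_pos : 0 < kap := by
  have hIntg : Integrable (fun x : ℝ => |x|) (gaussianReal 0 1) :=
    (IsGaussian.integrable_id (μ := gaussianReal 0 1)).abs
  have h0 : 0 ≤ kap := integral_nonneg fun x => abs_nonneg x
  rcases h0.lt_or_eq with h | h
  · exact h
  · exfalso
    have h1 := (integral_eq_zero_iff_of_nonneg (fun x => abs_nonneg x) hIntg).1 h.symm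
    have h2 : Var[id; gaussianReal 0 1] = Var[(0 : ℝ → ℝ); gaussianReal 0 1] := by
      refine variance_congr ?_
      filter_upwards [h1] with x hx
      simpa using hx
    rw [variance_id_gaussianReal, variance_zero] at h2
    simp at h2

lemma integral_abs_coord {n : ℕ} (i : Fin n) :
    ∫ y : EuclideanSpace ℝ (Fin n), |y i| ∂(stdGaussian _) = kap := by
  rw [← map_pi_eq_stdGaussian, integral_map (by fun_prop) (by fun_prop)]
  exact integral_comp_eval (μ := fun _ : Fin n => gaussianReal 0 1) (f := fun s => |s|)
    (by fun_prop)

/-- sign changes as isometries -/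
def signIsom {n : ℕ} (σ : Fin n → Bool) : EuclideanSpace ℝ (Fin n) ≃ₗᵢ[ℝ] EuclideanSpace ℝ (Fin n) :=
  LinearIsometryEquiv.piLpCongrRight 2 fun i =>
    if σ i then LinearIsometryEquiv.refl ℝ ℝ else LinearIsometryEquiv.neg ℝ

lemma signIsom_apply {n : ℕ} (σ : Fin n → Bool) (y : EuclideanSpace ℝ (Fin n)) (i : Fin n) :
    signIsom σ y i = radSign (σ i) * y i := by
  simp only [signIsom, LinearIsometryEquiv.piLpCongrRight_apply, radSign]
  by_cases hb : σ i = true <;> simp [hb]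

lemma rad_gauss {n : ℕ} {ι : Type*} [Fintype ι] (v : ι → Fin n → ℝ) :
    kap * radV v ≤ ∫ y : EuclideanSpace ℝ (Fin n), ‖fun h => ∑ i, y i * v h i‖ ∂(stdGaussian _) := by
  have hcoord : ∀ i : Fin n, Integrable (fun y : EuclideanSpace ℝ (Fin n) => y i) (stdGaussian _) := by
    intro i
    exact (EuclideanSpace.proj (𝕜 := ℝ) i : EuclideanSpace ℝ (Fin n) →L[ℝ] ℝ).integrable_comp
      (IsGaussian.integrable_id (μ := stdGaussian (EuclideanSpace ℝ (Fin n))))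
  have hΦ : ∀ σ : Fin n → Bool, ∫ y : EuclideanSpace ℝ (Fin n), ‖fun h => ∑ i, y i * v h i‖
      ∂(stdGaussian _) = ∫ y : EuclideanSpace ℝ (Fin n),
        ‖fun h => ∑ i, radSign (σ i) * (y i * v h i)‖ ∂(stdGaussian _) := by
    intro σ
    rw [← integral_comp_isom (signIsom σ)]
    simp only [signIsom_apply, mul_assoc]
  have hIntg : ∀ (σ : Fin n → Bool), Integrable (fun y : EuclideanSpace ℝ (Fin n) =>
      (fun h => ∑ i, radSign (σ i) * (y i * v h i))) (stdGaussian _) := by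
    intro σ
    refine Integrable.of_eval fun h => ?_
    exact integrable_finsetSum _ fun i _ => ((hcoord i).mul_const _).const_mul _
  have hIntg2 : ∀ (σ : Fin n → Bool), Integrable (fun y : EuclideanSpace ℝ (Fin n) =>
      (fun h => ∑ i, radSign (σ i) * (|y i| * v h i))) (stdGaussian _) := by
    intro σ
    refine Integrable.of_eval fun h => ?_
    exact integrable_finsetSum _ fun i _ => ((hcoord i).abs.mul_const _).const_mul _
  have h1 : ∫ y : EuclideanSpace ℝ (Fin n), ‖fun h => ∑ i, y i * v h i‖ ∂(stdGaussian _) =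
      ∫ y : EuclideanSpace ℝ (Fin n), radV (fun h i => y i * v h i) ∂(stdGaussian _) := by
    unfold radV
    rw [integral_div, integral_finsetSum _ fun σ _ => (hIntg σ).norm]
    rw [Finset.sum_congr rfl fun σ _ => (hΦ σ).symm]
    simp
  have h2 : ∀ y : EuclideanSpace ℝ (Fin n), radV (fun h i => y i * v h i) =
      radV (fun h i => |y i| * v h i) := by
    intro y
    rw [← radV_sign (fun i => decide (0 ≤ y i)) (fun h i => y i * v h i)]
    congr 1
    funext h i
    rw [← mul_assoc]
    congr 1
    unfold radSign
    by_cases hy : 0 ≤ y i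
    · simp [hy, abs_of_nonneg hy]
    · simp [hy, abs_of_neg (not_le.1 hy)]
  rw [h1]
  simp only [h2]
  unfold radV
  rw [integral_div, integral_finsetSum _ fun σ _ => (hIntg2 σ).norm, ← mul_div_assoc,
    Finset.mul_sum]
  refine div_le_div_of_nonneg_right (Finset.sum_le_sum fun σ _ => ?_) (by positivity)
  refine le_trans (le_of_eq ?_) (norm_integral_le_integral_norm _)
  have e : ∫ y : EuclideanSpace ℝ (Fin n), (fun h => ∑ i, radSign (σ i) * (|y i| * v h i))
      ∂(stdGaussian _) = kap • (fun h => ∑ i, radSign (σ i) * v h i) := by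
    funext h
    rw [eval_integral (fun h => (hIntg2 σ).eval h)]
    rw [integral_finsetSum _ fun i _ => ((hcoord i).abs.mul_const _).const_mul _]
    simp only [Pi.smul_apply, smul_eq_mul, Finset.mul_sum]
    refine Finset.sum_congr rfl fun i _ => ?_
    rw [integral_const_mul, integral_mul_const, integral_abs_coord]
    ring
  rw [e, norm_smul, Real.norm_of_nonneg kap_pos.le]



/-! ### From the isonormal process to the standard Gaussian measure -/

lemma iso_gauss {n : ℕ} {Ω : Type*} [MeasurableSpace Ω] {μ : Measure Ω} [IsProbabilityMeasure μ]
    {W : EuclideanSpace ℝ (Fin n) → Ω → ℝ} (hW : IsIsonormal μ W) :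
    ∃ Γ : Ω → EuclideanSpace ℝ (Fin n), Measurable Γ ∧ μ.map Γ = stdGaussian _ ∧
      ∀ h, ∀ᵐ ω ∂μ, W h ω = inner ℝ h (Γ ω) := by
  set e : Fin n → EuclideanSpace ℝ (Fin n) := fun i => EuclideanSpace.basisFun (Fin n) ℝ i with he
  have hsum : ∀ t : EuclideanSpace ℝ (Fin n), ∑ i, t i • e i = t := by
    intro t
    have := (EuclideanSpace.basisFun (Fin n) ℝ).sum_repr t
    simpa [he] using this
  set Γ : Ω → EuclideanSpace ℝ (Fin n) := fun ω => WithLp.toLp 2 fun i => W (e i) ω with hΓ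
  have hinner : ∀ (t : EuclideanSpace ℝ (Fin n)) ω, inner ℝ t (Γ ω) = ∑ i, t i * W (e i) ω := by
    intro t ω
    simp [hΓ, PiLp.inner_apply, mul_comm]
  have hΓm : Measurable Γ := by
    have : Measurable fun ω => (fun i => W (e i) ω) := measurable_pi_lambda _ fun i => hW.meas _
    exact (WithLp.measurable_toLp 2 _).comp this
  refine ⟨Γ, hΓm, ?_, ?_⟩
  · have : IsProbabilityMeasure (μ.map Γ) := Measure.isProbabilityMeasure_map hΓm.aemeasurable
    apply Measure.ext_of_charFun
    funext t
    rw [charFun_stdGaussian]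
    have h1 := hW.gaussian n e (fun i => t i)
    rw [hsum] at h1
    have h2 : charFun (μ.map Γ) t = charFun (μ.map fun ω => ∑ i, t i * W (e i) ω) 1 := by
      have hm : Measurable fun ω => ∑ i, t i * W (e i) ω :=
        Finset.measurable_sum _ fun i _ => (hW.meas _).const_mul _
      rw [charFun_apply, charFun_apply, integral_map hΓm.aemeasurable (by fun_prop),
        integral_map hm.aemeasurable (by fun_prop)]
      refine integral_congr_ae ?_
      filter_upwards with ω
      rw [real_inner_comm, hinner]
      simp
    rw [h2, h1, charFun_gaussianReal]
    simp
    ring_nf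
  · intro h
    have h1 := hW.gaussian (n + 1) (Fin.cons h e) (Fin.cons 1 fun i => - h i)
    have hz : ∑ i, (Fin.cons 1 (fun i => - h i) : Fin (n + 1) → ℝ) i •
        (Fin.cons h e : Fin (n + 1) → EuclideanSpace ℝ (Fin n)) i = 0 := by
      rw [Fin.sum_univ_succ]
      simp [hsum]
    rw [hz] at h1
    simp only [nnnorm_zero, ne_eq, OfNat.ofNat_ne_zero, not_false_eq_true, zero_pow,
      gaussianReal_zero_var] at h1
    set D : Ω → ℝ := fun ω => ∑ i, (Fin.cons 1 (fun i => - h i) : Fin (n + 1) → ℝ) i *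
        W ((Fin.cons h e : Fin (n + 1) → EuclideanSpace ℝ (Fin n)) i) ω with hD
    have hDm : Measurable D := Finset.measurable_sum _ fun i _ => (hW.meas _).const_mul _
    have h2 : ∀ᵐ y ∂(μ.map D), y = 0 := by
      rw [h1]
      rw [ae_dirac_eq]
      rfl
    have h3 : ∀ᵐ ω ∂μ, D ω = 0 := ae_of_ae_map hDm.aemeasurable h2
    filter_upwards [h3] with ω hω
    rw [hinner]
    simp only [hD, Fin.sum_univ_succ, Fin.cons_zero, Fin.cons_succ, one_mul, neg_mul,
      Finset.sum_neg_distrib] at hω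
    linarith

lemma modulus_eq {n : ℕ} {Ω : Type*} [MeasurableSpace Ω] {μ : Measure Ω} [IsProbabilityMeasure μ]
    {W : EuclideanSpace ℝ (Fin n) → Ω → ℝ} (hW : IsIsonormal μ W)
    {A : Set (EuclideanSpace ℝ (Fin n))} (hA : A.Countable) {ε : ℝ} (hε : 0 ≤ ε) :
    modulus μ W A ε = ∫ y, qs A ε y ∂(stdGaussian _) := by
  obtain ⟨Γ, hΓm, hΓ, hae⟩ := iso_gauss hW
  have h1 : ∀ᵐ ω ∂μ, ∀ h ∈ A, W h ω = inner ℝ h (Γ ω) := by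
    rw [ae_ball_iff hA]
    exact fun h _ => hae h
  rw [← hΓ, integral_map hΓm.aemeasurable (qs_continuous A hε).aestronglyMeasurable]
  refine integral_congr_ae ?_
  filter_upwards [h1] with ω hω
  unfold qs
  congr 1
  ext a
  simp only [Set.mem_ofPred_eq]
  constructor
  · rintro ⟨f, hf, g, hg, h, rfl⟩
    exact ⟨f, hf, g, hg, h, by rw [hω f hf, hω g hg]⟩
  · rintro ⟨f, hf, g, hg, h, rfl⟩
    exact ⟨f, hf, g, hg, h, by rw [hω f hf, hω g hg]⟩

/-! ### Properties of `psiEmp` -/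

/-- `embL2` as a linear map. -/
def embLin {S : Type*} (n : ℕ) (x : Fin n → S) : (S → ℝ) →ₗ[ℝ] EuclideanSpace ℝ (Fin n) where
  toFun := embL2 n x
  map_add' f g := by ext i; simp [embL2, add_div]
  map_smul' c f := by ext i; simp [embL2, mul_div_assoc]

lemma embL2_apply {S : Type*} (n : ℕ) (x : Fin n → S) (f : S → ℝ) (i : Fin n) :
    embL2 n x f i = f (x i) / √n := rfl

section psi
variable {S : Type*} {Ω : Type*} [MeasurableSpace Ω] {n : ℕ} {μ : Measure Ω}
  {W : EuclideanSpace ℝ (Fin n) → Ω → ℝ} {𝓖 : Set (S → ℝ)} {x : Fin n → S}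

lemma modulus_nonneg {A : Set (EuclideanSpace ℝ (Fin n))} {ε : ℝ} : 0 ≤ modulus μ W A ε := by
  refine integral_nonneg fun ω => Real.sSup_nonneg ?_
  rintro a ⟨f, -, g, -, -, rfl⟩
  exact abs_nonneg _

lemma psiSet_nonneg {δ : ℝ} (hδ : 0 ≤ δ) : ∀ a ∈ {a : ℝ | ∃ ε : ℝ, 0 < ε ∧
    a = modulus μ W (embL2 n x '' 𝓖) ε + δ * Real.sqrt (coveringNum (embL2 n x '' 𝓖) ε)},
    0 ≤ a := by
  rintro a ⟨ε, -, rfl⟩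
  exact add_nonneg modulus_nonneg (by positivity)

lemma psiSet_nonempty {δ : ℝ} : {a : ℝ | ∃ ε : ℝ, 0 < ε ∧
    a = modulus μ W (embL2 n x '' 𝓖) ε + δ * Real.sqrt (coveringNum (embL2 n x '' 𝓖) ε)}.Nonempty :=
  ⟨_, 1, one_pos, rfl⟩

lemma psiEmp_mono {δ δ' : ℝ} (hδ : 0 ≤ δ) (h : δ ≤ δ') :
    psiEmp n μ W 𝓖 x δ ≤ psiEmp n μ W 𝓖 x δ' := by
  unfold psiEmp
  refine mul_le_mul_of_nonneg_left ?_ (by positivity)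
  refine le_csInf psiSet_nonempty ?_
  rintro a ⟨ε, hε, rfl⟩
  refine (csInf_le ⟨0, psiSet_nonneg hδ⟩ ⟨ε, hε, rfl⟩).trans ?_
  gcongr

lemma psiEmp_scale {δ l : ℝ} (hδ : 0 ≤ δ) (hl : 0 ≤ l) (hl1 : l ≤ 1) :
    l * psiEmp n μ W 𝓖 x δ ≤ psiEmp n μ W 𝓖 x (l * δ) := by
  unfold psiEmp
  rw [mul_left_comm]
  refine mul_le_mul_of_nonneg_left ?_ (by positivity)
  refine le_csInf psiSet_nonempty ?_
  rintro a ⟨ε, hε, rfl⟩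
  have h1 := csInf_le ⟨0, psiSet_nonneg (μ := μ) (W := W) (𝓖 := 𝓖) (x := x) hδ⟩ ⟨ε, hε, rfl⟩
  have h2 := mul_le_mul_of_nonneg_left h1 hl
  have h3 : 0 ≤ modulus μ W (embL2 n x '' 𝓖) ε := modulus_nonneg
  refine h2.trans ?_
  nlinarith

lemma psiEmp_growth : ∃ a b : ℝ, ∀ δ, 0 ≤ δ → psiEmp n μ W 𝓖 x δ ≤ a + b * δ := by
  refine ⟨√(π / (2 * n)) * modulus μ W (embL2 n x '' 𝓖) 1,
    √(π / (2 * n)) * √(coveringNum (embL2 n x '' 𝓖) 1), fun δ hδ => ?_⟩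
  unfold psiEmp
  have h1 := csInf_le ⟨0, psiSet_nonneg (μ := μ) (W := W) (𝓖 := 𝓖) (x := x) hδ⟩ ⟨1, one_pos, rfl⟩
  have h2 := mul_le_mul_of_nonneg_left h1 (Real.sqrt_nonneg (π / (2 * n)))
  refine h2.trans (le_of_eq ?_)
  ring

end psi

lemma exists_fixed {φ : ℝ → ℝ} (hm : ∀ δ δ', 0 ≤ δ → δ ≤ δ' → φ δ ≤ φ δ') {a b : ℝ}
    (hg : ∀ δ, 0 ≤ δ → φ δ ≤ a + b * δ) {u : ℝ} (hu : 0 ≤ u) (huφ : u ≤ φ √u) :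
    ∃ ρ, u ≤ ρ ∧ ρ = φ √ρ := by
  set U : Set ℝ := {v | 0 ≤ v ∧ v ≤ φ √v} with hU
  have hbdd : BddAbove U := by
    refine ⟨2 * a + b ^ 2, ?_⟩
    rintro v ⟨hv, hvφ⟩
    have h1 := hvφ.trans (hg _ (Real.sqrt_nonneg v))
    have h2 := Real.sq_sqrt hv
    nlinarith [sq_nonneg (b - √v)]
  have huU : u ∈ U := ⟨hu, huφ⟩
  have hus : u ≤ sSup U := le_csSup hbdd huU
  have h1 : sSup U ≤ φ √(sSup U) := by
    refine csSup_le ⟨u, huU⟩ ?_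
    intro v hv
    exact hv.2.trans (hm _ _ (Real.sqrt_nonneg _) (Real.sqrt_le_sqrt (le_csSup hbdd hv)))
  have h2 : φ √(sSup U) ∈ U :=
    ⟨(hu.trans hus).trans h1, hm _ _ (Real.sqrt_nonneg _) (Real.sqrt_le_sqrt h1)⟩
  exact ⟨sSup U, hus, le_antisymm h1 (le_csSup hbdd h2)⟩

/-- Rademacher complexity of a subset of the hull is controlled by `psiEmp`. -/
lemma rad_le_psi {S : Type*} {Ω : Type*} [MeasurableSpace Ω] {n : ℕ} (hn : 0 < n)
    {μ : Measure Ω} [IsProbabilityMeasure μ]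
    {W : EuclideanSpace ℝ (Fin n) → Ω → ℝ} (hW : IsIsonormal μ W) {𝓖 : Set (S → ℝ)}
    (hc : 𝓖.Countable) (hG : ∀ g ∈ 𝓖, ∀ s, g s ∈ Icc (0 : ℝ) 1) (x : Fin n → S)
    {g₀ : S → ℝ} (hg₀ : g₀ ∈ convexHull ℝ 𝓖) (T : Finset (S → ℝ))
    (hT : ∀ h ∈ T, ∃ g ∈ convexHull ℝ 𝓖, h = g - g₀) (hTb : ∀ h ∈ T, ∀ s, |h s| ≤ 1)
    {R : ℝ} (hR : 0 ≤ R) (hTR : ∀ h ∈ T, ∑ i, |h (x i)| ≤ R) :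
    kap * radV (fun (h : T) i => (h : S → ℝ) (x i)) ≤ 2 * n * psiEmp n μ W 𝓖 x √(R / n) := by
  have hn' : (0 : ℝ) < n := by exact_mod_cast hn
  have hsn : 0 < √(n : ℝ) := Real.sqrt_pos.2 hn'
  set A := embL2 n x '' 𝓖 with hA
  set δ := √(R / n) with hδ
  have hAc : A.Countable := hc.image _
  have hAb : Bornology.IsBounded A := by
    rw [isBounded_iff_forall_norm_le]
    refine ⟨1, ?_⟩
    rintro _ ⟨g, hg, rfl⟩
    rw [EuclideanSpace.norm_eq, Real.sqrt_le_left (by norm_num), one_pow]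
    calc ∑ i, ‖embL2 n x g i‖ ^ 2 ≤ ∑ i : Fin n, 1 / (n : ℝ) := by
          refine Finset.sum_le_sum fun i _ => ?_
          rw [embL2_apply, Real.norm_eq_abs, sq_abs, div_pow, Real.sq_sqrt hn'.le]
          have := hG g hg (x i)
          refine div_le_div_of_nonneg_right ?_ hn'.le
          nlinarith [this.1, this.2]
      _ = 1 := by simp [hn'.ne']
  set u : T → EuclideanSpace ℝ (Fin n) := fun h => embL2 n x h with hu
  have hu1 : ∀ h, ∃ a ∈ convexHull ℝ A, ∃ b ∈ convexHull ℝ A, u h = a - b := by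
    intro h
    obtain ⟨g, hg, hgh⟩ := hT h h.2
    have himg : ∀ f ∈ convexHull ℝ 𝓖, embL2 n x f ∈ convexHull ℝ A := by
      intro f hf
      have := (embLin n x).image_convexHull 𝓖
      have h2 : embLin n x f ∈ embLin n x '' convexHull ℝ 𝓖 := ⟨f, hf, rfl⟩
      rw [this] at h2
      exact h2
    refine ⟨_, himg g hg, _, himg g₀ hg₀, ?_⟩
    rw [hu]
    simp only [hgh]
    exact (embLin n x).map_sub g g₀
  have hu2 : ∀ h, ‖u h‖ ≤ δ := by
    intro h
    rw [EuclideanSpace.norm_eq, hδ]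
    refine Real.sqrt_le_sqrt ?_
    have h1 := hTR h h.2
    calc ∑ i, ‖u h i‖ ^ 2 ≤ ∑ i, |(h : S → ℝ) (x i)| / (n : ℝ) := by
          refine Finset.sum_le_sum fun i _ => ?_
          rw [hu, embL2_apply, Real.norm_eq_abs, sq_abs, div_pow, Real.sq_sqrt hn'.le]
          refine div_le_div_of_nonneg_right ?_ hn'.le
          have h3 := hTb h h.2 (x i)
          rw [← sq_abs]
          nlinarith [abs_nonneg ((h : S → ℝ) (x i))]
      _ ≤ R / n := by rw [← Finset.sum_div]; gcongr
  have h1 := rad_gauss (fun (h : T) i => (h : S → ℝ) (x i))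
  have e : ∀ y : EuclideanSpace ℝ (Fin n), ‖fun h : T => ∑ i, y i * (h : S → ℝ) (x i)‖ =
      √n * ‖fun h => (inner ℝ (u h) y : ℝ)‖ := by
    intro y
    have : (fun h : T => ∑ i, y i * (h : S → ℝ) (x i)) =
        √(n : ℝ) • (fun h => (inner ℝ (u h) y : ℝ)) := by
      funext h
      simp only [Pi.smul_apply, smul_eq_mul, PiLp.inner_apply, Finset.mul_sum, hu, embL2_apply]
      refine Finset.sum_congr rfl fun i _ => ?_
      simp only [RCLike.inner_apply, conj_trivial]
      field_simp
    rw [this, norm_smul, Real.norm_of_nonneg hsn.le]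
  simp only [e] at h1
  rw [integral_const_mul] at h1
  have h2 : ∀ ε : ℝ, 0 < ε → kap * radV (fun (h : T) i => (h : S → ℝ) (x i)) / (2 * √n) ≤
      modulus μ W A ε + δ * √(coveringNum A ε) := by
    intro ε hε
    have h3 := hull_bound hAb hε u (Real.sqrt_nonneg _) hu1 hu2
    rw [← modulus_eq hW hAc hε.le] at h3
    rw [div_le_iff₀ (by positivity)]
    refine h1.trans ?_
    have h4 := mul_le_mul_of_nonneg_left h3 hsn.le
    refine h4.trans ?_
    have h5 : 0 ≤ δ * √(coveringNum A ε : ℝ) := by positivity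
    nlinarith
  have h3 : kap * radV (fun (h : T) i => (h : S → ℝ) (x i)) / (2 * √n) ≤
      sInf {a : ℝ | ∃ ε : ℝ, 0 < ε ∧ a = modulus μ W A ε + δ * √(coveringNum A ε)} := by
    refine le_csInf psiSet_nonempty ?_
    rintro a ⟨ε, hε, rfl⟩
    exact h2 ε hε
  unfold psiEmp
  rw [div_le_iff₀ (by positivity)] at h3
  refine h3.trans ?_
  rw [← hA]
  set I := sInf {a : ℝ | ∃ ε : ℝ, 0 < ε ∧ a = modulus μ W A ε + δ * √(coveringNum A ε)} with hI
  have hI0 : 0 ≤ I := Real.sInf_nonneg (psiSet_nonneg (Real.sqrt_nonneg _))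
  have h4 : √(n : ℝ) ≤ n * √(π / (2 * n)) := by
    have e1 : (n : ℝ) = √n * √n := (Real.mul_self_sqrt hn'.le).symm
    have e2 : √(n : ℝ) * √(π / (2 * n)) = √(π / 2) := by
      rw [← Real.sqrt_mul hn'.le]
      congr 1
      field_simp
    have e3 : (1 : ℝ) ≤ √(π / 2) := by
      rw [Real.one_le_sqrt]
      linarith [Real.pi_gt_three]
    calc √(n : ℝ) = √n * 1 := by ring
      _ ≤ √n * (√n * √(π / (2 * n))) := by rw [e2]; gcongr
      _ = (√n * √n) * √(π / (2 * n)) := by ring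
      _ = n * √(π / (2 * n)) := by rw [← e1]
  have h5 := mul_le_mul_of_nonneg_left h4 hI0
  calc I * (2 * √n) = 2 * (I * √n) := by ring
    _ ≤ 2 * (I * (n * √(π / (2 * n)))) := by gcongr
    _ = _ := by ring

/-- constants -/
def dd : ℝ := min 1 (kap / 4096)

lemma dd_pos : 0 < dd := lt_min one_pos (div_pos kap_pos (by norm_num))

lemma lowRad_of_rhat {S : Type*} {Ω : Type*} [MeasurableSpace Ω] {n : ℕ} (hn : 0 < n)
    {μ : Measure Ω} [IsProbabilityMeasure μ]
    {W : EuclideanSpace ℝ (Fin n) → Ω → ℝ} (hW : IsIsonormal μ W) {𝓖 : Set (S → ℝ)}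
    (hc : 𝓖.Countable) (hG : ∀ g ∈ 𝓖, ∀ s, g s ∈ Icc (0 : ℝ) 1) (x : Fin n → S)
    {g₀ : S → ℝ} (hg₀ : g₀ ∈ convexHull ℝ 𝓖) (T : Finset (S → ℝ))
    (hT : ∀ h ∈ T, ∃ g ∈ convexHull ℝ 𝓖, h = g - g₀) (hTb : ∀ h ∈ T, ∀ s, |h s| ≤ 1)
    {R : ℝ} (hR : 0 < R) {rh : ℝ}
    (hmax : ∀ ρ : ℝ, ρ = psiEmp n μ W 𝓖 x (Real.sqrt ρ) → ρ ≤ rh)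
    (hrh : rh < dd ^ 2 * (R / n)) : lowRad T R x := by
  intro T' hT' hsum
  by_contra hcon
  push Not at hcon
  have hn' : (0 : ℝ) < n := by exact_mod_cast hn
  have hsub := Finset.mem_powerset.1 hT'
  have h1 := rad_le_psi hn hW hc hG x hg₀ T' (fun h hh => hT h (hsub hh))
    (fun h hh => hTb h (hsub hh)) (R := 5 * R) (by positivity) hsum
  set r := R / n with hr
  have hr0 : 0 < r := div_pos hR hn'
  have hRr : R = n * r := by rw [hr]; field_simp
  have h2 : kap * r / 1024 ≤ psiEmp n μ W 𝓖 x √(5 * R / n) := by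
    have h3 := mul_le_mul_of_nonneg_left hcon kap_pos.le
    have h4 := h3.trans h1
    rw [hRr] at h4 ⊢
    have h5 : kap * r / 1024 * (2 * n) ≤
        psiEmp n μ W 𝓖 x √(5 * (n * r) / n) * (2 * n) := by linarith
    exact le_of_mul_le_mul_right h5 (by positivity)
  have h3 : √(5 * R / n) ≤ 3 * √r := by
    rw [mul_div_assoc, ← hr, Real.sqrt_mul (by norm_num)]
    gcongr
    rw [Real.sqrt_le_left (by norm_num)]
    norm_num
  have hd := dd_pos
  have hd1 : dd ≤ 1 := min_le_left _ _
  have hd2 : dd ≤ kap / 4096 := min_le_right _ _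
  have h4 := h2.trans (psiEmp_mono (Real.sqrt_nonneg _) h3)
  have h5 := psiEmp_scale (μ := μ) (W := W) (𝓖 := 𝓖) (x := x) (δ := 3 * √r) (l := dd / 3)
    (by positivity) (by positivity) (by linarith)
  have h6 : dd / 3 * (3 * √r) = √(dd ^ 2 * r) := by
    rw [Real.sqrt_mul (by positivity), Real.sqrt_sq hd.le]; ring
  rw [h6] at h5
  have h7 : dd ^ 2 * r ≤ psiEmp n μ W 𝓖 x √(dd ^ 2 * r) := by
    refine le_trans ?_ h5
    refine le_trans ?_ (mul_le_mul_of_nonneg_left h4 (by positivity))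
    have := mul_le_mul_of_nonneg_left hd2 (by positivity : 0 ≤ dd * r)
    have hk : 0 ≤ dd * r * kap := by have := kap_pos; positivity
    nlinarith
  obtain ⟨a, b, hab⟩ := psiEmp_growth (μ := μ) (W := W) (𝓖 := 𝓖) (x := x)
  obtain ⟨ρ, hρ1, hρ2⟩ := exists_fixed (fun δ δ' => psiEmp_mono) hab (by positivity) h7
  have := hmax ρ hρ2
  linarith


lemma hull_fun {S : Type*} [MeasurableSpace S] {𝓖 : Set (S → ℝ)}
    (hm : ∀ g ∈ 𝓖, Measurable g) (hG : ∀ g ∈ 𝓖, ∀ s, g s ∈ Icc (0 : ℝ) 1)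
    {g : S → ℝ} (hg : g ∈ convexHull ℝ 𝓖) : Measurable g ∧ ∀ s, g s ∈ Icc (0 : ℝ) 1 := by
  have : convexHull ℝ 𝓖 ⊆ {g | Measurable g ∧ ∀ s, g s ∈ Icc (0 : ℝ) 1} := by
    refine convexHull_min (fun g hg => ⟨hm g hg, hG g hg⟩) ?_
    rintro g ⟨h1, h2⟩ g' ⟨h1', h2'⟩ a b ha hb hab
    refine ⟨(h1.const_smul a).add (h1'.const_smul b), fun s => ?_⟩
    have := convex_Icc (0 : ℝ) 1 (h2 s) (h2' s) ha hb hab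
    simpa using this
  exact this hg

lemma exists_net {S : Type*} {G : Set (S → ℝ)} (hf : G.Finite)
    (hG : ∀ g ∈ G, ∀ s, g s ∈ Icc (0 : ℝ) 1) {η : ℝ} (hη : 0 < η) :
    ∃ T : Finset (S → ℝ), ↑T ⊆ convexHull ℝ G ∧
      ∀ g ∈ convexHull ℝ G, ∃ g' ∈ T, ∀ s, |g' s - g s| ≤ η := by
  classical
  have he := hf.convexHull_eq_image (R := ℝ)
  letI := hf.fintype
  set L := (∑ x : G, (LinearMap.proj (R := ℝ) (φ := fun _ : G => ℝ) x).smulRight x.1) with hL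
  have hLa : ∀ w s, L w s = ∑ x : G, w x * x.1 s := by
    intro w s
    simp [hL, LinearMap.sum_apply, Finset.sum_apply]
  have he : convexHull ℝ G = L '' stdSimplex ℝ G := he
  have hc : 0 < η / (Fintype.card G + 1) := by positivity
  obtain ⟨t, hts, htf, htc⟩ := (isCompact_stdSimplex ℝ G).finite_cover_balls hc
  refine ⟨htf.toFinset.image L, ?_, ?_⟩
  · rw [he]
    intro g hg
    simp only [Finset.coe_image, Finite.coe_toFinset] at hg
    exact image_mono hts hg
  · rw [he]
    rintro _ ⟨w, hw, rfl⟩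
    have := htc hw
    simp only [mem_iUnion, Metric.mem_ball, exists_prop] at this
    obtain ⟨v, hv, hd⟩ := this
    refine ⟨L v, Finset.mem_image_of_mem _ (by simpa using hv), fun s => ?_⟩
    rw [hLa, hLa, ← Finset.sum_sub_distrib]
    calc |∑ x : G, (v x * x.1 s - w x * x.1 s)| ≤ ∑ x : G, |v x * x.1 s - w x * x.1 s| :=
          Finset.abs_sum_le_sum_abs _ _
      _ ≤ ∑ x : G, η / (Fintype.card G + 1) := by
          refine Finset.sum_le_sum fun x _ => ?_
          rw [← sub_mul, abs_mul]
          have h1 : |v x - w x| ≤ η / (Fintype.card G + 1) := by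
            rw [← Real.dist_eq, dist_comm]
            exact ((dist_le_pi_dist w v x).trans hd.le)
          have h2 := hG x.1 x.2 s
          rw [abs_of_nonneg h2.1]
          exact (mul_le_of_le_one_right (abs_nonneg _) h2.2).trans h1
      _ ≤ η := by
          rw [Finset.sum_const, nsmul_eq_mul, Finset.card_univ, mul_div_assoc', div_le_iff₀ (by positivity)]
          nlinarith

lemma level_fin {S : Type*} [MeasurableSpace S] (P : Measure S) [IsProbabilityMeasure P]
    {n : ℕ} (hn : 0 < n) {𝓖 : Set (S → ℝ)} (hc : 𝓖.Countable) (hm : ∀ g ∈ 𝓖, Measurable g)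
    (hG : ∀ g ∈ 𝓖, ∀ s, g s ∈ Icc (0 : ℝ) 1)
    {Ω : Type*} [MeasurableSpace Ω] {μ : Measure Ω} [IsProbabilityMeasure μ]
    {W : EuclideanSpace ℝ (Fin n) → Ω → ℝ} (hW : IsIsonormal μ W)
    {g₀ : S → ℝ} (hg₀ : g₀ ∈ convexHull ℝ 𝓖) {rhat : (Fin n → S) → ℝ}
    (hmax : ∀ x ρ, ρ = psiEmp n μ W 𝓖 x (√ρ) → ρ ≤ rhat x) {R : ℝ} (hR : 64 ≤ R)
    {G : Set (S → ℝ)} (hf : G.Finite) (hGs : G ⊆ 𝓖) :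
    (Measure.pi fun _ : Fin n => P) {x | ∃ g ∈ convexHull ℝ G, (∀ i, g (x i) = g₀ (x i)) ∧
      n * ∫ s, |g s - g₀ s| ∂P = R ∧ rhat x < dd ^ 2 * (R / n)} ≤
      ENNReal.ofReal (4 * Real.exp (-(R / 5242880))) := by
  classical
  have hn' : (0 : ℝ) < n := by exact_mod_cast hn
  obtain ⟨T, hT, hTn⟩ := exists_net hf (fun g hg => hG g (hGs hg)) (η := R / n / 8) (by positivity)
  have h0 := hull_fun hm hG hg₀
  have hTh : ∀ g ∈ T, Measurable g ∧ ∀ s, g s ∈ Icc (0 : ℝ) 1 := fun g hg =>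
    hull_fun hm hG (convexHull_mono hGs (hT hg))
  have hb : ∀ h ∈ T.image (fun g => g - g₀), ∀ s, |h s| ≤ 1 := by
    intro h hh s
    obtain ⟨g, hg, rfl⟩ := Finset.mem_image.1 hh
    have h1 := (hTh g hg).2 s
    have h2 := h0.2 s
    rw [Pi.sub_apply, abs_le]
    constructor <;> linarith [h1.1, h1.2, h2.1, h2.2]
  refine le_trans (measure_mono ?_) (double_sampling P (T.image fun g => g - g₀) hR ?_ hb)
  · rintro x ⟨g, hg, hgx, hgR, hrh⟩
    refine ⟨?_, ?_⟩
    · obtain ⟨g', hg', hη⟩ := hTn g hg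
      refine ⟨g' - g₀, Finset.mem_image_of_mem _ hg', ?_⟩
      have hgf := hull_fun hm hG (convexHull_mono hGs hg)
      have hIntg : ∀ f : S → ℝ, (Measurable f ∧ ∀ s, f s ∈ Icc (0 : ℝ) 1) →
          Integrable (fun s => |f s - g₀ s|) P := by
        rintro f ⟨hf1, hf2⟩
        refine Integrable.of_bound (hf1.sub h0.1).abs.aestronglyMeasurable 1 ?_
        filter_upwards with s
        have h1 := hf2 s
        have h2 := h0.2 s
        rw [Real.norm_eq_abs, abs_abs, abs_le]
        constructor <;> linarith [h1.1, h1.2, h2.1, h2.2]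
      have i1 := hIntg g hgf
      have i2 := hIntg g' (hTh g' hg')
      have hle : ∫ s, |g' s - g₀ s| ∂P ≤ ∫ s, |g s - g₀ s| ∂P + R / n / 8 := by
        calc _ ≤ ∫ s, (|g s - g₀ s| + R / n / 8) ∂P := by
              refine integral_mono i2 (i1.add (integrable_const _)) fun s => ?_
              have := abs_add_le (g' s - g s) (g s - g₀ s)
              have h2 := hη s
              rw [sub_add_sub_cancel] at this
              show |g' s - g₀ s| ≤ |g s - g₀ s| + R / n / 8
              linarith
          _ = _ := by rw [integral_add i1 (integrable_const _)]; simp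
      have hge : ∫ s, |g s - g₀ s| ∂P ≤ ∫ s, |g' s - g₀ s| ∂P + R / n / 8 := by
        calc _ ≤ ∫ s, (|g' s - g₀ s| + R / n / 8) ∂P := by
              refine integral_mono i1 (i2.add (integrable_const _)) fun s => ?_
              have := abs_add_le (g s - g' s) (g' s - g₀ s)
              have h2 := hη s
              rw [abs_sub_comm] at h2
              rw [sub_add_sub_cancel] at this
              show |g s - g₀ s| ≤ |g' s - g₀ s| + R / n / 8
              linarith
          _ = _ := by rw [integral_add i2 (integrable_const _)]; simp
      have hnn : (n : ℝ) * (R / n / 8) = R / 8 := by field_simp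
      have hle' := mul_le_mul_of_nonneg_left hle hn'.le
      have hge' := mul_le_mul_of_nonneg_left hge hn'.le
      rw [mul_add, hnn] at hle' hge'
      simp only [Pi.sub_apply]
      refine ⟨by linarith, by linarith, ?_⟩
      calc ∑ i, |g' (x i) - g₀ (x i)| ≤ ∑ i : Fin n, R / n / 8 := by
            refine Finset.sum_le_sum fun i _ => ?_
            rw [← hgx i]; exact hη _
        _ = R / 8 := by rw [Finset.sum_const, nsmul_eq_mul, Finset.card_univ, Fintype.card_fin, hnn]
    · refine lowRad_of_rhat hn hW hc hG x hg₀ _ ?_ hb (by linarith) (hmax x) hrh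
      intro h hh
      obtain ⟨g, hg, rfl⟩ := Finset.mem_image.1 hh
      exact ⟨g, convexHull_mono hGs (hT hg), rfl⟩
  · intro h hh
    obtain ⟨g, hg, rfl⟩ := Finset.mem_image.1 hh
    exact (hTh g hg).1.sub h0.1

lemma level {S : Type*} [MeasurableSpace S] (P : Measure S) [IsProbabilityMeasure P]
    {n : ℕ} (hn : 0 < n) {𝓖 : Set (S → ℝ)} (hc : 𝓖.Countable) (hm : ∀ g ∈ 𝓖, Measurable g)
    (hG : ∀ g ∈ 𝓖, ∀ s, g s ∈ Icc (0 : ℝ) 1)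
    {Ω : Type*} [MeasurableSpace Ω] {μ : Measure Ω} [IsProbabilityMeasure μ]
    {W : EuclideanSpace ℝ (Fin n) → Ω → ℝ} (hW : IsIsonormal μ W)
    {g₀ : S → ℝ} (hg₀ : g₀ ∈ convexHull ℝ 𝓖) {rhat : (Fin n → S) → ℝ}
    (hmax : ∀ x ρ, ρ = psiEmp n μ W 𝓖 x (√ρ) → ρ ≤ rhat x) {R : ℝ} (hR : 64 ≤ R) :
    (Measure.pi fun _ : Fin n => P) {x | ∃ g ∈ convexHull ℝ 𝓖, (∀ i, g (x i) = g₀ (x i)) ∧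
      n * ∫ s, |g s - g₀ s| ∂P = R ∧ rhat x < dd ^ 2 * (R / n)} ≤
      ENNReal.ofReal (4 * Real.exp (-(R / 5242880))) := by
  classical
  have hne : 𝓖.Nonempty := convexHull_nonempty_iff.1 ⟨g₀, hg₀⟩
  obtain ⟨e, he⟩ := hc.exists_eq_range hne
  let G : ℕ → Set (S → ℝ) := fun m => e '' {k | k < m}
  have hGf : ∀ m, (G m).Finite := fun m => (Set.finite_lt_nat m).image _
  have hGs : ∀ m, G m ⊆ 𝓖 := fun m => by
    rw [he]; exact image_subset_range _ _
  have hGm : Monotone G := fun a b hab => image_mono fun k (hk : k < a) => lt_of_lt_of_le hk hab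
  let B : ℕ → Set (Fin n → S) := fun m => {x | ∃ g ∈ convexHull ℝ (G m),
    (∀ i, g (x i) = g₀ (x i)) ∧
      n * ∫ s, |g s - g₀ s| ∂P = R ∧ rhat x < dd ^ 2 * (R / n)}
  have hBm : Monotone B := by
    rintro a b hab x ⟨g, hg, h⟩
    exact ⟨g, convexHull_mono (hGm hab) hg, h⟩
  have hsub : {x | ∃ g ∈ convexHull ℝ 𝓖, (∀ i, g (x i) = g₀ (x i)) ∧
      n * ∫ s, |g s - g₀ s| ∂P = R ∧ rhat x < dd ^ 2 * (R / n)} ⊆ ⋃ m, B m := by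
    rintro x ⟨g, hg, h⟩
    rw [convexHull_eq_union_convexHull_finite_subsets] at hg
    simp only [mem_iUnion] at hg
    obtain ⟨t, ht, hgt⟩ := hg
    have : ∃ m, ↑t ⊆ G m := by
      clear hgt
      induction t using Finset.induction_on with
      | empty => exact ⟨0, by simp⟩
      | insert a t ha ih =>
        rw [Finset.coe_insert, Set.insert_subset_iff] at ht
        obtain ⟨m, hm⟩ := ih ht.2
        have ha' := ht.1
        rw [he] at ha'
        obtain ⟨k, rfl⟩ := ha'
        refine ⟨max m (k + 1), ?_⟩
        rw [Finset.coe_insert, Set.insert_subset_iff]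
        exact ⟨⟨k, by simp, rfl⟩, hm.trans (hGm (le_max_left _ _))⟩
    obtain ⟨m, hm⟩ := this
    exact mem_iUnion.2 ⟨m, g, convexHull_mono hm hgt, h⟩
  refine (measure_mono hsub).trans ?_
  rw [hBm.measure_iUnion]
  exact iSup_le fun m => level_fin P hn hc hm hG hW hg₀ hmax hR (hGf m) (hGs m)


lemma psiEmp_nonneg {S Ω : Type*} [MeasurableSpace Ω] {n : ℕ} {μ : Measure Ω}
    {W : EuclideanSpace ℝ (Fin n) → Ω → ℝ} {𝓖 : Set (S → ℝ)} {x : Fin n → S} {δ : ℝ}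
    (hδ : 0 ≤ δ) : 0 ≤ psiEmp n μ W 𝓖 x δ := by
  refine mul_nonneg (Real.sqrt_nonneg _) (Real.sInf_nonneg ?_)
  rintro a ⟨ε, _, rfl⟩
  exact add_nonneg modulus_nonneg (by positivity)

/-- There is a universal constant `K > 0` such that: for any countable
class `𝓖` of measurable `[0,1]`-valued functions, an i.i.d. sample of size `n ≥ 3` with
law `P`, a target `g₀ ∈ conv 𝓖`, an empirical minimizer `ĝₙ` of `Pₙ|g - g₀|` over
`conv 𝓖`, and `r̂ₙ(𝓖)` the largest solution of `r = ψₙ(𝓖, √r)` (with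
`ψₙ(𝓖, δ) = √(π/(2n)) inf_{ε>0}(ω(𝓖,ε) + δ√(N(𝓖,ε)))` computed in `L²(Pₙ)`), for every
`t > 0`, with probability at least `1 - 2e^{-t}`,
`P|ĝₙ - g₀| ≤ K (r̂ₙ(𝓖) + (t + log log n)/n)`. -/
theorem generalization_bound_convexHull :
    ∃ K : ℝ, 0 < K ∧
      ∀ (S : Type) [MeasurableSpace S] (P : Measure S) [IsProbabilityMeasure P]
        (n : ℕ), 3 ≤ n →
        ∀ 𝓖 : Set (S → ℝ), 𝓖.Countable → (∀ g ∈ 𝓖, Measurable g) →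
          (∀ g ∈ 𝓖, ∀ s, g s ∈ Icc (0 : ℝ) 1) →
          ∀ (Ω : Type) [MeasurableSpace Ω] (μ : Measure Ω) [IsProbabilityMeasure μ]
            (W : EuclideanSpace ℝ (Fin n) → Ω → ℝ), IsIsonormal μ W →
            ∀ g₀ ∈ convexHull ℝ 𝓖,
              ∀ ghat : (Fin n → S) → S → ℝ,
                (∀ x, ghat x ∈ convexHull ℝ 𝓖 ∧
                  ∀ g ∈ convexHull ℝ 𝓖,
                    empMean n x (fun s => |ghat x s - g₀ s|) ≤
                      empMean n x (fun s => |g s - g₀ s|)) →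
                ∀ rhat : (Fin n → S) → ℝ,
                  (∀ x, rhat x = psiEmp n μ W 𝓖 x (Real.sqrt (rhat x)) ∧
                    ∀ ρ : ℝ, ρ = psiEmp n μ W 𝓖 x (Real.sqrt ρ) → ρ ≤ rhat x) →
                  ∀ t : ℝ, 0 < t →
                    ENNReal.ofReal (1 - 2 * Real.exp (-t)) ≤
                      (Measure.pi fun _ : Fin n => P) {x | ∫ s, |ghat x s - g₀ s| ∂P ≤
                        K * (rhat x + (t + Real.log (Real.log n)) / n)} := by
  have hd := dd_pos
  refine ⟨15728640 + 2 / dd ^ 2, by positivity, ?_⟩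
  intro S _ P _ n hn 𝓖 hc hm hG Ω _ μ _ W hW g₀ hg₀ ghat hgh rhat hrh t ht
  have hn' : (0 : ℝ) < n := by
    have : 0 < n := by omega
    exact_mod_cast this
  by_cases hq : Real.exp (-t) ≤ 1 / 2
  swap
  · rw [ENNReal.ofReal_of_nonpos (by linarith)]
    exact zero_le
  have hthalf : 1 / 2 ≤ t := by
    have := Real.add_one_le_exp (-t)
    linarith
  have hll : 0 ≤ Real.log (Real.log n) := by
    refine Real.log_nonneg ?_
    rw [Real.le_log_iff_exp_le hn']
    have h3 : (3 : ℝ) ≤ n := by exact_mod_cast hn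
    linarith [Real.exp_one_lt_d9]
  set Q := Measure.pi fun _ : Fin n => P with hQ
  set good := {x | ∫ s, |ghat x s - g₀ s| ∂P ≤
    (15728640 + 2 / dd ^ 2) * (rhat x + (t + Real.log (Real.log n)) / n)} with hgood
  let Rk : ℕ → ℝ := fun k => 2 ^ k * (15728640 * t)
  let B : ℕ → Set (Fin n → S) := fun k => {x | ∃ g ∈ convexHull ℝ 𝓖,
    (∀ i, g (x i) = g₀ (x i)) ∧
      n * ∫ s, |g s - g₀ s| ∂P = Rk k ∧ rhat x < dd ^ 2 * (Rk k / n)}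
  have hsub : goodᶜ ⊆ ⋃ k, B k := by
    intro x hx
    have hx : (15728640 + 2 / dd ^ 2) * (rhat x + (t + Real.log (Real.log n)) / n) <
      ∫ s, |ghat x s - g₀ s| ∂P := not_le.1 hx
    set p := ∫ s, |ghat x s - g₀ s| ∂P with hp
    have hr0 : 0 ≤ rhat x := by
      rw [(hrh x).1]
      exact psiEmp_nonneg (Real.sqrt_nonneg _)
    have hA : 15728640 * t / n ≤ p := by
      refine le_trans ?_ hx.le
      have h1 : 15728640 * t / n ≤ 15728640 * (rhat x + (t + Real.log (Real.log n)) / n) := by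
        have : t / n ≤ (t + Real.log (Real.log n)) / n :=
          div_le_div_of_nonneg_right (by linarith) hn'.le
        rw [mul_div_assoc]
        linarith
      refine h1.trans (mul_le_mul_of_nonneg_right ?_ (by positivity))
      have : 0 ≤ 2 / dd ^ 2 := by positivity
      linarith
    have hBr : 2 / dd ^ 2 * rhat x < p := by
      refine lt_of_le_of_lt ?_ hx
      refine mul_le_mul (by norm_num) ?_ hr0 (by positivity)
      have : 0 ≤ (t + Real.log (Real.log n)) / n := by positivity
      linarith
    have hr0p : 0 < 15728640 * t / n := by positivity
    have hpp : 0 < p := lt_of_lt_of_le hr0p hA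
    obtain ⟨k, hk1, hk2⟩ := exists_nat_pow_near (x := p / (15728640 * t / n)) (y := 2)
      ((one_le_div hr0p).2 hA) (by norm_num)
    rw [le_div_iff₀ hr0p] at hk1
    rw [div_lt_iff₀ hr0p, pow_succ] at hk2
    have hRk : Rk k / n = 2 ^ k * (15728640 * t / n) := by simp only [Rk]; ring
    set r := Rk k / n with hr
    have hrpos : 0 < r := by rw [hRk]; positivity
    have hrp : r ≤ p := by rw [hRk]; exact hk1
    have hp2 : p < 2 * r := by rw [hRk]; linarith
    have hzero : ∀ i, ghat x (x i) = g₀ (x i) := by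
      have h1 := (hgh x).2 g₀ hg₀
      simp only [empMean, sub_self, abs_zero, Finset.sum_const_zero, zero_div] at h1
      have h2 : ∑ i, |ghat x (x i) - g₀ (x i)| ≤ 0 := by
        have := (div_le_iff₀ hn').1 h1
        simpa using this
      have h3 := le_antisymm h2 (Finset.sum_nonneg fun i _ => abs_nonneg _)
      rw [Finset.sum_eq_zero_iff_of_nonneg fun i _ => abs_nonneg _] at h3
      intro i
      have := h3 i (Finset.mem_univ i)
      rw [abs_eq_zero] at this
      linarith
    refine mem_iUnion.2 ⟨k, g₀ + (r / p) • (ghat x - g₀), ?_, ?_, ?_, ?_⟩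
    · exact (convex_convexHull ℝ 𝓖).add_smul_sub_mem hg₀ (hgh x).1
        ⟨by positivity, (div_le_one hpp).2 hrp⟩
    · intro i
      simp [hzero i]
    · have h1 : ∀ s, |(g₀ + (r / p) • (ghat x - g₀)) s - g₀ s| =
          (r / p) * |ghat x s - g₀ s| := by
        intro s
        simp only [Pi.add_apply, Pi.smul_apply, Pi.sub_apply, smul_eq_mul, add_sub_cancel_left]
        rw [abs_mul, abs_of_pos (by positivity)]
      simp only [h1]
      rw [integral_const_mul, ← hp, div_mul_cancel₀ _ hpp.ne', hr]
      field_simp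
    · rw [← hr]
      have h1 : 2 / dd ^ 2 * rhat x < 2 * r := hBr.trans hp2
      rw [div_mul_eq_mul_div, div_lt_iff₀ (by positivity)] at h1
      linarith
  have hB : ∀ k, Q (B k) ≤ ENNReal.ofReal (Real.exp (-t) * (1 / 2) ^ k) := by
    intro k
    have hk1 : (1 : ℝ) + k ≤ 2 ^ k := by
      have := one_add_mul_le_pow (a := (1 : ℝ)) (by norm_num) k
      norm_num at this
      exact this
    have hk0 : (0 : ℝ) ≤ k := Nat.cast_nonneg k
    refine (level P (by omega) hc hm hG hW hg₀ (fun x => (hrh x).2) (R := Rk k) ?_).trans ?_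
    · have : 1 * (15728640 * t) ≤ 2 ^ k * (15728640 * t) :=
        mul_le_mul_of_nonneg_right (by linarith) (by positivity)
      simp only [Rk]
      linarith
    · refine ENNReal.ofReal_le_ofReal ?_
      have he : Real.exp (-(Rk k / 5242880)) ≤ Real.exp (-t) ^ (3 + k) := by
        rw [← Real.exp_nat_mul]
        refine Real.exp_le_exp.2 ?_
        simp only [Rk]
        push_cast
        have : (1 + k) * t ≤ 2 ^ k * t := mul_le_mul_of_nonneg_right hk1 ht.le
        have : 0 ≤ k * t := by positivity
        linarith
      have hpos := Real.exp_pos (-t)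
      have h2 : Real.exp (-t) ^ k ≤ (1 / 2) ^ k := pow_le_pow_left₀ hpos.le hq k
      have h3 : Real.exp (-t) ^ 2 ≤ (1 / 2) ^ 2 := pow_le_pow_left₀ hpos.le hq 2
      calc 4 * Real.exp (-(Rk k / 5242880)) ≤ 4 * Real.exp (-t) ^ (3 + k) := by linarith
        _ = Real.exp (-t) * (4 * Real.exp (-t) ^ 2) * Real.exp (-t) ^ k := by ring
        _ ≤ Real.exp (-t) * 1 * (1 / 2) ^ k := by
            gcongr
            linarith
        _ = _ := by ring
  have hbad : Q goodᶜ ≤ ENNReal.ofReal (2 * Real.exp (-t)) := by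
    refine (measure_mono hsub).trans ((measure_iUnion_le B).trans ?_)
    refine (ENNReal.tsum_le_tsum hB).trans ?_
    rw [← ENNReal.ofReal_tsum_of_nonneg (fun k => by positivity)
      (summable_geometric_two.mul_left _), tsum_mul_left, tsum_geometric_two, mul_comm]
  have h1 : (1 : ENNReal) ≤ Q good + Q goodᶜ := by
    calc (1 : ENNReal) = Q univ := by simp [hQ]
      _ = Q (good ∪ goodᶜ) := by rw [union_compl_self]
      _ ≤ _ := measure_union_le _ _
  rw [ENNReal.ofReal_sub _ (by positivity), ENNReal.ofReal_one, tsub_le_iff_right]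
  exact h1.trans (by gcongr)
end
end

section
/- Let 𝓕 be a totally bounded subset of diameter 1 of a separable Hilbert space 𝓗 and W an isonormal Gaussian process on 𝓗; for ε > 0 let 𝓕^{ε} denote a maximal ε-separated subset of 𝓕. There is a universal constant K such that for every integer k ≥ 0, H(𝓕, 2^{−k})^{1/2} ≤ K · Σ_{i=0}^{k} 2^{i} · ω(𝓕^{2^{−i−1}}, 2^{2−i}). -/
open MeasureTheory ProbabilityTheory Real Set

noncomputable section

lemma iso_mgf {H : Type*} [NormedAddCommGroup H] [InnerProductSpace ℝ H]
    {Ω : Type*} [MeasurableSpace Ω] {μ : Measure Ω} {W : H → Ω → ℝ} (hW : IsIsonormal μ W)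
    {n : ℕ} (h : Fin n → H) (c : Fin n → ℝ) :
    ∫ ω, Real.exp (∑ i, c i * W (h i) ω) ∂μ = Real.exp (‖∑ i, c i • h i‖ ^ 2 / 2) := by
  have := mgf_gaussianReal (hW.gaussian n h c) 1
  simpa [mgf] using this

lemma iso_integrable_exp {H : Type*} [NormedAddCommGroup H] [InnerProductSpace ℝ H]
    {Ω : Type*} [MeasurableSpace Ω] {μ : Measure Ω} {W : H → Ω → ℝ} (hW : IsIsonormal μ W)
    {n : ℕ} (h : Fin n → H) (c : Fin n → ℝ) :
    Integrable (fun ω => Real.exp (∑ i, c i * W (h i) ω)) μ := by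
  by_contra hc
  have h1 := iso_mgf hW h c
  rw [integral_undef hc] at h1
  exact (Real.exp_pos _).ne h1

lemma tilt_map {H : Type*} [NormedAddCommGroup H] [InnerProductSpace ℝ H]
    {Ω : Type*} [MeasurableSpace Ω] {μ : Measure Ω} [IsProbabilityMeasure μ]
    {W : H → Ω → ℝ} (hW : IsIsonormal μ W)
    {n : ℕ} (h : Fin n → H) (c : Fin n → ℝ) :
    (μ.tilted (fun ω => ∑ i, c i * W (h i) ω)).map (fun ω i => W (h i) ω) =
      μ.map (fun ω i => W (h i) ω + inner ℝ (h i) (∑ j, c j • h j)) := by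
  have hm := hW.meas
  have hP : IsProbabilityMeasure (μ.tilted (fun ω => ∑ i, c i * W (h i) ω)) :=
    isProbabilityMeasure_tilted (iso_integrable_exp hW h c)
  have hX : Measurable (fun ω (i : Fin n) => W (h i) ω) := by fun_prop
  have hY : Measurable (fun ω (i : Fin n) => W (h i) ω + inner ℝ (h i) (∑ j, c j • h j)) := by
    fun_prop
  apply Measure.ext_of_charFunDual
  ext L
  rw [charFunDual_apply, charFunDual_apply, integral_map hX.aemeasurable (by fun_prop),
    integral_map hY.aemeasurable (by fun_prop)]
  obtain ⟨u, hu⟩ : ∃ u : Fin n → ℝ, ∀ x, L x = ∑ i, u i * x i := by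
    refine ⟨fun i => L (fun j => if i = j then 1 else 0), fun x => ?_⟩
    have := LinearMap.pi_apply_eq_sum_univ L.toLinearMap x
    simpa [mul_comm] using this
  simp only [hu]
  set P := μ.tilted (fun ω => ∑ i, c i * W (h i) ω) with hPdef
  have hmgf1 : ∀ t : ℝ, mgf (fun ω => ∑ i, u i * W (h i) ω) P t =
      Real.exp (t * inner ℝ (∑ i, u i • h i) (∑ i, c i • h i) +
        t ^ 2 * ‖∑ i, u i • h i‖ ^ 2 / 2) := by
    intro t
    rw [mgf, hPdef, integral_exp_tilted, iso_mgf hW]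
    have e : ∀ ω, ((fun ω => ∑ i, c i * W (h i) ω) + fun ω => t * ∑ i, u i * W (h i) ω) ω =
        ∑ i, (c i + t * u i) * W (h i) ω := by
      intro ω
      simp [Finset.mul_sum, add_mul, Finset.sum_add_distrib, mul_assoc]
    simp_rw [e]
    rw [iso_mgf hW, ← Real.exp_sub]
    congr 1
    have e2 : ∑ i, (c i + t * u i) • h i = ∑ i, c i • h i + t • ∑ i, u i • h i := by
      simp [Finset.smul_sum, add_smul, Finset.sum_add_distrib, mul_smul]
    rw [e2, norm_add_sq_real, norm_smul, mul_pow, inner_smul_right, real_inner_comm,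
      Real.norm_eq_abs, sq_abs]
    ring
  have hmgf2 : ∀ t : ℝ, mgf (fun ω => ∑ i, u i * (W (h i) ω + inner ℝ (h i) (∑ j, c j • h j))) μ t =
      Real.exp (t * inner ℝ (∑ i, u i • h i) (∑ i, c i • h i) +
        t ^ 2 * ‖∑ i, u i • h i‖ ^ 2 / 2) := by
    intro t
    have e : ∀ ω, t * ∑ i, u i * (W (h i) ω + inner ℝ (h i) (∑ j, c j • h j)) =
        t * inner ℝ (∑ i, u i • h i) (∑ i, c i • h i) + ∑ i, (t * u i) * W (h i) ω := by
      intro ω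
      rw [sum_inner, Finset.mul_sum, Finset.mul_sum, ← Finset.sum_add_distrib]
      refine Finset.sum_congr rfl fun i _ => ?_
      rw [inner_smul_left]
      simp
      ring
    rw [mgf]
    simp_rw [e, Real.exp_add]
    rw [integral_const_mul, iso_mgf hW]
    congr 2
    have e2 : ∑ i, (t * u i) • h i = t • ∑ i, u i • h i := by
      simp [Finset.smul_sum, mul_smul]
    rw [e2, norm_smul, mul_pow, Real.norm_eq_abs, sq_abs]
  have hset : integrableExpSet (fun ω => ∑ i, u i * W (h i) ω) P = Set.univ := by
    ext t
    simp only [integrableExpSet, Set.mem_ofPred_eq, mem_univ, iff_true]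
    rw [← mgf_pos_iff, hmgf1]
    exact Real.exp_pos _
  have key := eqOn_complexMGF_of_mgf (μ := P) (μ' := μ)
    (X := fun ω => ∑ i, u i * W (h i) ω)
    (Y := fun ω => ∑ i, u i * (W (h i) ω + inner ℝ (h i) (∑ j, c j • h j)))
    (by ext t; rw [hmgf1, hmgf2])
  have k2 := key (x := Complex.I) (by simp [hset])
  simpa only [complexMGF, mul_comm Complex.I] using k2

lemma shift_prob {H : Type*} [NormedAddCommGroup H] [InnerProductSpace ℝ H]
    {Ω : Type*} [MeasurableSpace Ω] {μ : Measure Ω} [IsProbabilityMeasure μ]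
    {W : H → Ω → ℝ} (hW : IsIsonormal μ W)
    {n : ℕ} (h : Fin n → H) (c : Fin n → ℝ) (B : Set (Fin n → ℝ)) (hB : MeasurableSet B)
    (hp : 1 / 2 ≤ μ.real {ω | (fun i => W (h i) ω + inner ℝ (h i) (∑ j, c j • h j)) ∈ B}) :
    1 / 4 * Real.exp (-‖∑ j, c j • h j‖ ^ 2) ≤ μ.real {ω | (fun i => W (h i) ω) ∈ B} := by
  have hm := hW.meas
  have hX : Measurable (fun ω (i : Fin n) => W (h i) ω) := by fun_prop
  have hY : Measurable (fun ω (i : Fin n) => W (h i) ω + inner ℝ (h i) (∑ j, c j • h j)) := by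
    fun_prop
  have hBX : MeasurableSet {ω | (fun i => W (h i) ω) ∈ B} := hX hB
  set Z : Ω → ℝ := fun ω => ∑ i, c i * W (h i) ω with hZ
  set v := ‖∑ j, c j • h j‖ ^ 2 with hv
  set S := {ω | (fun i => W (h i) ω) ∈ B} with hS
  have h1 : μ {ω | (fun i => W (h i) ω + inner ℝ (h i) (∑ j, c j • h j)) ∈ B} =
      (μ.tilted Z) S := by
    have := congrArg (fun m => m B) (tilt_map hW h c)
    simp only [Measure.map_apply hX hB, Measure.map_apply hY hB] at this
    exact this.symm
  have hi1 : ∫ ω, Real.exp (Z ω) ∂μ = Real.exp (v / 2) := iso_mgf hW h c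
  have hint1 : Integrable (fun ω => Real.exp (Z ω)) μ := iso_integrable_exp hW h c
  have e2 : ∀ ω, Real.exp (Z ω) ^ 2 = Real.exp (∑ i, (2 * c i) * W (h i) ω) := by
    intro ω
    rw [← Real.exp_nat_mul, hZ]
    simp [Finset.mul_sum, mul_assoc]
  have hi2 : ∫ ω, Real.exp (Z ω) ^ 2 ∂μ = Real.exp (2 * v) := by
    simp_rw [e2]
    rw [iso_mgf hW]
    have e3 : ∑ i, (2 * c i) • h i = (2 : ℝ) • ∑ i, c i • h i := by
      simp [Finset.smul_sum, mul_smul]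
    rw [e3, norm_smul, mul_pow, ← hv]
    norm_num
    ring
  have hint2 : Integrable (fun ω => Real.exp (Z ω) ^ 2) μ := by
    simp_rw [e2]
    exact iso_integrable_exp hW h _
  have h2 : (μ.tilted Z).real S = ∫ ω in S, Real.exp (Z ω) / Real.exp (v / 2) ∂μ := by
    rw [measureReal_def, tilted_apply_eq_ofReal_integral, ENNReal.toReal_ofReal, hi1]
    exact integral_nonneg fun ω => by positivity
  rw [measureReal_def, h1, ← measureReal_def, h2] at hp
  have h3 : ∫ ω in S, Real.exp (Z ω) / Real.exp (v / 2) ∂μ ≤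
      ∫ ω in S, (Real.exp v + Real.exp (-2 * v) / 4 * Real.exp (Z ω) ^ 2) ∂μ := by
    apply integral_mono
    · exact (hint1.div_const _).integrableOn
    · exact ((integrable_const _).add (hint2.const_mul _)).integrableOn
    · intro ω
      have ea : Real.exp v = Real.exp (v/2) ^ 2 := by
        rw [← Real.exp_nat_mul]; congr 1; push_cast; ring
      have eb : Real.exp (-2 * v) = 1 / Real.exp (v/2) ^ 4 := by
        rw [← Real.exp_nat_mul, one_div, ← Real.exp_neg]; congr 1; push_cast; ring
      simp only []
      rw [ea, eb]
      have := Real.exp_pos (v/2)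
      generalize Real.exp (v/2) = a at *
      generalize Real.exp (Z ω) = b at *
      have : a ^ 2 + 1 / a ^ 4 / 4 * b ^ 2 - b / a = (a - b / (2 * a ^ 2)) ^ 2 := by
        field_simp
        ring
      nlinarith [sq_nonneg (a - b / (2 * a ^ 2))]
  have h4 : ∫ ω in S, (Real.exp v + Real.exp (-2 * v) / 4 * Real.exp (Z ω) ^ 2) ∂μ ≤
      Real.exp v * μ.real S + 1 / 4 := by
    rw [integral_add (integrable_const _) (hint2.const_mul _).integrableOn, integral_const_mul]
    have h5 : ∫ ω in S, Real.exp (Z ω) ^ 2 ∂μ ≤ Real.exp (2 * v) := by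
      rw [← hi2]
      exact setIntegral_le_integral hint2 (Filter.Eventually.of_forall fun ω => by positivity)
    have h6 : Real.exp (-2 * v) / 4 * ∫ ω in S, Real.exp (Z ω) ^ 2 ∂μ ≤ 1 / 4 := by
      calc _ ≤ Real.exp (-2 * v) / 4 * Real.exp (2 * v) := by gcongr
        _ = 1 / 4 := by
          rw [div_mul_eq_mul_div, ← Real.exp_add]; simp
    have h7 : ∫ ω in S, Real.exp v ∂μ = Real.exp v * μ.real S := by
      simp [mul_comm]
    linarith
  have h8 : 1 / 4 ≤ Real.exp v * μ.real S := by linarith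
  rw [Real.exp_neg]
  have := Real.exp_pos v
  rw [← div_eq_mul_inv, div_le_iff₀ this]
  linarith

lemma iso_integrable {H : Type*} [NormedAddCommGroup H] [InnerProductSpace ℝ H]
    {Ω : Type*} [MeasurableSpace Ω] {μ : Measure Ω} {W : H → Ω → ℝ} (hW : IsIsonormal μ W)
    (f : H) : Integrable (W f) μ := by
  have h1 := hW.gaussian 1 (fun _ => f) (fun _ => 1)
  simp only [Finset.univ_unique, one_mul, Finset.sum_const, Finset.card_singleton,
    one_smul] at h1
  have h2 : Integrable id (μ.map (W f)) := by
    rw [h1, ← memLp_one_iff_integrable]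
    exact memLp_id_gaussianReal' 1 (by simp)
  exact (integrable_map_measure (by fun_prop) (hW.meas f).aemeasurable).1 h2

lemma sup_facts {H : Type*} [NormedAddCommGroup H] [InnerProductSpace ℝ H]
    {Ω : Type*} [MeasurableSpace Ω] {μ : Measure Ω} {W : H → Ω → ℝ} (hW : IsIsonormal μ W)
    (A : Set H) (hA : A.Finite) (δ : ℝ) :
    Integrable (fun ω => sSup {a : ℝ | ∃ f ∈ A, ∃ g ∈ A, ‖f - g‖ ≤ δ ∧ a = |W f ω - W g ω|}) μ ∧
    (∀ ω, 0 ≤ sSup {a : ℝ | ∃ f ∈ A, ∃ g ∈ A, ‖f - g‖ ≤ δ ∧ a = |W f ω - W g ω|}) ∧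
    (∀ ω, ∀ f ∈ A, ∀ g ∈ A, ‖f - g‖ ≤ δ → |W f ω - W g ω| ≤
      sSup {a : ℝ | ∃ f ∈ A, ∃ g ∈ A, ‖f - g‖ ≤ δ ∧ a = |W f ω - W g ω|}) := by
  classical
  set P := (hA.toFinset ×ˢ hA.toFinset).filter (fun p => ‖p.1 - p.2‖ ≤ δ) with hP
  have hG : ∀ ω, {a : ℝ | ∃ f ∈ A, ∃ g ∈ A, ‖f - g‖ ≤ δ ∧ a = |W f ω - W g ω|} =
      (fun p : H × H => |W p.1 ω - W p.2 ω|) '' (P : Set (H × H)) := by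
    intro ω
    ext a
    constructor
    · rintro ⟨f, hf, g, hg, hd, rfl⟩
      exact ⟨(f, g), by simp [hP, hf, hg, hd], rfl⟩
    · rintro ⟨⟨f, g⟩, hp, rfl⟩
      simp [hP] at hp
      exact ⟨f, hp.1.1, g, hp.1.2, hp.2, rfl⟩
  refine ⟨?_, ?_, ?_⟩
  · rcases P.eq_empty_or_nonempty with h0 | h0
    · simp_rw [hG, h0]
      simp
    · have hi : Integrable (P.sup' h0 (fun p : H × H => fun ω => |W p.1 ω - W p.2 ω|)) μ := by
        refine Finset.sup'_induction h0 _ (p := fun f => Integrable f μ)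
          (fun a ha b hb => ha.sup hb) (fun p _ => ?_)
        exact ((iso_integrable hW p.1).sub (iso_integrable hW p.2)).abs
      refine hi.congr (Filter.Eventually.of_forall fun ω => ?_)
      simp only [hG]
      rw [Finset.sup'_apply, Finset.sup'_eq_csSup_image]
  · intro ω
    apply Real.sSup_nonneg
    rintro a ⟨f, hf, g, hg, hd, rfl⟩
    positivity
  · intro ω f hf g hg hd
    apply le_csSup
    · rw [hG]
      exact (P.finite_toSet.image _).bddAbove
    · exact ⟨f, hf, g, hg, hd, rfl⟩

lemma one_sub_cos_le_abs (y : ℝ) : 1 - Real.cos y ≤ |y| := by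
  rcases le_or_gt |y| 2 with h | h
  · have := Real.one_sub_sq_div_two_le_cos (x := y)
    have h2 : y ^ 2 = |y| ^ 2 := (sq_abs y).symm
    nlinarith [abs_nonneg y]
  · have := Real.neg_one_le_cos y
    linarith

lemma abs_lower {H : Type*} [NormedAddCommGroup H] [InnerProductSpace ℝ H]
    {Ω : Type*} [MeasurableSpace Ω] {μ : Measure Ω} [IsProbabilityMeasure μ]
    {W : H → Ω → ℝ} (hW : IsIsonormal μ W)
    (f g : H) (a : ℝ) (ha : 0 < a) (hfg : a ≤ ‖f - g‖) :
    a / 3 ≤ ∫ ω, |W f ω - W g ω| ∂μ := by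
  have h1 := hW.gaussian 2 ![f, g] ![1 / a, - (1 / a)]
  set Y : Ω → ℝ := fun ω => ∑ i, ![1 / a, - (1 / a)] i * W (![f, g] i) ω with hY
  have hYe : ∀ ω, Y ω = (W f ω - W g ω) / a := by
    intro ω; simp [hY, Fin.sum_univ_two]; ring
  have hne : ‖∑ i, ![1 / a, - (1 / a)] i • ![f, g] i‖ = ‖f - g‖ / a := by
    simp [Fin.sum_univ_two]
    rw [← sub_eq_add_neg, ← smul_sub, norm_smul, norm_inv, Real.norm_of_nonneg ha.le]
    field_simp
  have hYm : Measurable Y := by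
    have := hW.meas
    fun_prop
  have hYi : Integrable Y μ := by
    refine (((iso_integrable hW f).sub (iso_integrable hW g)).div_const a).congr
      (Filter.Eventually.of_forall fun ω => ?_)
    simp [hYe]
  set σ := ‖∑ i, ![1 / a, - (1 / a)] i • ![f, g] i‖₊ with hσ
  have hσ1 : 1 ≤ (σ : ℝ) := by
    rw [hσ, coe_nnnorm, hne, le_div_iff₀ ha]; linarith
  have hcos : ∫ ω, Real.cos (Y ω) ∂μ = Real.exp (-(σ : ℝ) ^ 2 / 2) := by
    have h2 := charFun_gaussianReal (μ := 0) (v := σ ^ 2) 1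
    rw [← h1, charFun_apply_real, integral_map hYm.aemeasurable (by fun_prop)] at h2
    have h3 := congrArg Complex.re h2
    have h4 : (∫ ω, Complex.exp (((1 : ℝ) : ℂ) * (Y ω : ℂ) * Complex.I) ∂μ).re =
        ∫ ω, (Complex.exp (((1 : ℝ) : ℂ) * (Y ω : ℂ) * Complex.I)).re ∂μ := by
      symm
      apply integral_re (𝕜 := ℂ)
      refine Integrable.of_bound (C := 1) (by fun_prop) (Filter.Eventually.of_forall fun ω => ?_)
      rw [← Complex.ofReal_mul, Complex.norm_exp_ofReal_mul_I]
    rw [h4] at h3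
    have h5 : ∀ ω, (Complex.exp (((1 : ℝ) : ℂ) * (Y ω : ℂ) * Complex.I)).re = Real.cos (Y ω) := by
      intro ω
      rw [← Complex.ofReal_mul, Complex.exp_ofReal_mul_I_re, one_mul]
    simp_rw [h5] at h3
    rw [h3]
    have h6 : (((1 : ℝ) : ℂ) * ((0 : ℝ) : ℂ) * Complex.I -
        (((σ ^ 2 : NNReal) : ℝ) : ℂ) * ((1 : ℝ) : ℂ) ^ 2 / 2) =
        ((-(σ : ℝ) ^ 2 / 2 : ℝ) : ℂ) := by
      push_cast; ring
    rw [h6, Complex.exp_ofReal_re]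
  have hcosi : Integrable (fun ω => Real.cos (Y ω)) μ := by
    refine Integrable.of_bound (C := 1) (by fun_prop) (Filter.Eventually.of_forall fun ω => ?_)
    exact Real.abs_cos_le_one _
  have h7 : ∫ ω, (1 - Real.cos (Y ω)) ∂μ ≤ ∫ ω, |Y ω| ∂μ :=
    integral_mono ((integrable_const _).sub hcosi) hYi.abs (fun ω => one_sub_cos_le_abs _)
  rw [integral_sub (integrable_const _) hcosi, hcos] at h7
  have h8 : ∫ ω, |Y ω| ∂μ = (∫ ω, |W f ω - W g ω| ∂μ) / a := by
    rw [← integral_div]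
    congr 1
    ext ω
    rw [hYe, abs_div, abs_of_pos ha]
  have h9 : Real.exp (-(σ : ℝ) ^ 2 / 2) ≤ 2 / 3 := by
    have : Real.exp (-(σ : ℝ) ^ 2 / 2) = (Real.exp ((σ : ℝ) ^ 2 / 2))⁻¹ := by
      rw [← Real.exp_neg]; ring_nf
    rw [this, inv_le_comm₀ (Real.exp_pos _) (by norm_num)]
    have := Real.add_one_le_exp ((σ : ℝ) ^ 2 / 2)
    nlinarith
  rw [h8] at h7
  simp only [integral_const, probReal_univ, smul_eq_mul, mul_one] at h7
  have h10 : 1 / 3 ≤ (∫ ω, |W f ω - W g ω| ∂μ) / a := by linarith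
  rw [le_div_iff₀ ha] at h10
  linarith

lemma sudakov_local {H : Type*} [NormedAddCommGroup H] [InnerProductSpace ℝ H]
    {Ω : Type*} [MeasurableSpace Ω] {μ : Measure Ω} [IsProbabilityMeasure μ]
    {W : H → Ω → ℝ} (hW : IsIsonormal μ W)
    (A : Set H) (hA : A.Finite) (a : ℝ) (ha : 0 < a) {n : ℕ} (h : Fin n → H)
    (hhA : ∀ i, h i ∈ A) (hsep : ∀ i j, i ≠ j → a ≤ ‖h i - h j‖)
    (hdiam : ∀ i j, ‖h i - h j‖ ≤ 8 * a) :
    a * Real.sqrt (Real.log n) ≤ 33 * modulus μ W A (8 * a) := by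
  obtain ⟨hSi, hS0, hSle⟩ := sup_facts hW A hA (8 * a)
  set M := modulus μ W A (8 * a) with hM
  rw [modulus] at hM
  set S : Ω → ℝ := fun ω =>
    sSup {b : ℝ | ∃ f ∈ A, ∃ g ∈ A, ‖f - g‖ ≤ 8 * a ∧ b = |W f ω - W g ω|} with hS
  have hM0 : 0 ≤ M := by rw [hM]; exact integral_nonneg hS0
  rcases Nat.lt_or_ge n 2 with hn | hn
  · have : Real.log n = 0 := by interval_cases n <;> simp
    rw [this]; simp; exact hM0
  have hMa : a / 3 ≤ M := by
    have hne : (⟨0, by omega⟩ : Fin n) ≠ ⟨1, by omega⟩ := by simp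
    refine (abs_lower hW _ _ a ha (hsep _ _ hne)).trans ?_
    rw [hM]
    exact integral_mono ((iso_integrable hW _).sub (iso_integrable hW _)).abs hSi
      (fun ω => hSle ω _ (hhA _) _ (hhA _) (hdiam _ _))
  have hMpos : 0 < M := by linarith
  set l := 4 * M / a ^ 2 with hl
  have hlpos : 0 < l := by positivity
  have hla : l * a ^ 2 = 4 * M := by rw [hl]; field_simp
  have hPS : 1 / 2 ≤ μ.real {ω | S ω < 2 * M} := by
    have h1 := mul_meas_ge_le_integral_of_nonneg (Filter.Eventually.of_forall hS0) hSi (2 * M)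
    rw [← hM] at h1
    have hmeas : NullMeasurableSet {ω | 2 * M ≤ S ω} μ :=
      nullMeasurableSet_le aemeasurable_const hSi.aemeasurable
    have h2 : μ.real {ω | 2 * M ≤ S ω} ≤ 1 / 2 := by
      by_contra hc
      push Not at hc
      nlinarith
    have h3 : {ω | S ω < 2 * M} = {ω | 2 * M ≤ S ω}ᶜ := by
      ext ω; simp
    rw [h3, probReal_compl_eq_one_sub₀ hmeas]
    linarith
  set q : Fin n := ⟨0, by omega⟩
  set B : Fin n → Set (Fin n → ℝ) := fun p => {x | ∀ i, i ≠ p →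
    x i - l * ‖h i - h q‖ ^ 2 / 2 < x p - l * ‖h p - h q‖ ^ 2 / 2} with hB
  have hBm : ∀ p, MeasurableSet (B p) := by
    intro p
    have : B p = ⋂ i, ⋂ (_ : i ≠ p), {x : Fin n → ℝ |
        x i - l * ‖h i - h q‖ ^ 2 / 2 < x p - l * ‖h p - h q‖ ^ 2 / 2} := by
      ext x; simp [hB]
    rw [this]
    refine MeasurableSet.iInter fun i => MeasurableSet.iInter fun _ => ?_
    exact measurableSet_lt (by fun_prop) (by fun_prop)
  have hlow : ∀ p, 1 / 4 * Real.exp (-(l ^ 2 * (8 * a) ^ 2)) ≤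
      μ.real {ω | (fun i => W (h i) ω) ∈ B p} := by
    intro p
    set c : Fin n → ℝ := fun i => l * ((if i = p then 1 else 0) - (if i = q then 1 else 0)) with hc
    have hcs : ∑ j, c j • h j = l • (h p - h q) := by
      simp [hc, mul_smul, sub_smul, Finset.sum_sub_distrib, ← Finset.smul_sum]
    refine le_trans ?_ (shift_prob hW h c (B p) (hBm p) ?_)
    · rw [hcs, norm_smul, Real.norm_of_nonneg hlpos.le, mul_pow]
      have := hdiam p q
      have h0 : (l * ‖h p - h q‖) ^ 2 ≤ (l * (8 * a)) ^ 2 := by gcongr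
      have h1 : l ^ 2 * ‖h p - h q‖ ^ 2 ≤ l ^ 2 * (8 * a) ^ 2 := by linarith
      have h2 : Real.exp (-(l ^ 2 * (8 * a) ^ 2)) ≤
          Real.exp (-(l ^ 2 * ‖h p - h q‖ ^ 2)) := Real.exp_le_exp.2 (neg_le_neg h1)
      simpa only [mul_pow] using mul_le_mul_of_nonneg_left h2 (by norm_num : (0 : ℝ) ≤ 1 / 4)
    · refine hPS.trans (measureReal_mono ?_)
      intro ω hω i hip
      have hω' : S ω < 2 * M := hω
      have h1 := hSle ω _ (hhA i) _ (hhA p) (hdiam i p)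
      have h2 := le_abs_self (W (h i) ω - W (h p) ω)
      have h3 : W (h i) ω - W (h p) ω < 2 * M := by
        have : |W (h i) ω - W (h p) ω| ≤ S ω := h1
        linarith
      have h4 := hsep i p hip
      have h5 : l * a ^ 2 ≤ l * ‖h i - h p‖ ^ 2 := by gcongr
      have h6 : h i - h q = (h i - h p) + (h p - h q) := by abel
      have h7 : ‖h i - h q‖ ^ 2 = ‖h i - h p‖ ^ 2 + 2 * inner ℝ (h i - h p) (h p - h q)
          + ‖h p - h q‖ ^ 2 := by rw [h6, norm_add_sq_real]
      simp only [hcs, inner_smul_right]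
      rw [h7, inner_sub_left]
      nlinarith
  have hsum : ∑ p, μ.real {ω | (fun i => W (h i) ω) ∈ B p} ≤ 1 := by
    have hm := hW.meas
    have hX : Measurable (fun ω (i : Fin n) => W (h i) ω) := by fun_prop
    have := sum_measureReal_le_measureReal_univ (μ := μ) (s := Finset.univ)
      (t := fun p => {ω | (fun i => W (h i) ω) ∈ B p})
      (fun p _ => hX (hBm p)) (by
        intro p _ r _ hpr
        refine Set.disjoint_left.2 ?_
        intro ω h1 h2
        have h3 := h1 r hpr.symm
        have h4 := h2 p hpr
        linarith)
    simpa using this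
  have hcard : (n : ℝ) * (1 / 4 * Real.exp (-(l ^ 2 * (8 * a) ^ 2))) ≤ 1 := by
    refine le_trans ?_ hsum
    have := Finset.sum_le_sum (s := Finset.univ) (fun p _ => hlow p)
    simpa using this
  have hnpos : (0 : ℝ) < n := by positivity
  have hlog : Real.log n ≤ 2 + l ^ 2 * (8 * a) ^ 2 := by
    rw [Real.log_le_iff_le_exp hnpos, Real.exp_add]
    rw [Real.exp_neg] at hcard
    have he := Real.exp_pos (l ^ 2 * (8 * a) ^ 2)
    have h4 : (4 : ℝ) ≤ Real.exp 2 := by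
      have := Real.add_one_le_exp (1 : ℝ)
      have h2 : Real.exp 2 = Real.exp 1 * Real.exp 1 := by rw [← Real.exp_add]; norm_num
      rw [h2]; nlinarith
    have h5 : (n : ℝ) ≤ 4 * Real.exp (l ^ 2 * (8 * a) ^ 2) := by
      have : (n : ℝ) * (1 / 4 * (Real.exp (l ^ 2 * (8 * a) ^ 2))⁻¹) =
        n / (4 * Real.exp (l ^ 2 * (8 * a) ^ 2)) := by field_simp
      rw [this, div_le_one (by positivity)] at hcard
      exact hcard
    nlinarith
  have hfin : (a * Real.sqrt (Real.log n)) ^ 2 ≤ (33 * M) ^ 2 := by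
    rw [mul_pow, Real.sq_sqrt (Real.log_natCast_nonneg n)]
    have h1 : a ^ 2 * Real.log n ≤ a ^ 2 * (2 + l ^ 2 * (8 * a) ^ 2) := by gcongr
    have h2 : a ^ 2 * (2 + l ^ 2 * (8 * a) ^ 2) = 2 * a ^ 2 + 64 * (l * a ^ 2) ^ 2 := by ring
    rw [h2, hla] at h1
    nlinarith
  exact le_of_sq_le_sq hfin (by positivity)

lemma maxSep_net {E : Type*} [PseudoMetricSpace E] {F A : Set E} {ε : ℝ} (hε : 0 < ε)
    (hA : IsMaxSeparated F A ε) (x : E) (hx : x ∈ F) : ∃ y ∈ A, dist x y < ε := by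
  obtain ⟨hAF, hsep, hmax⟩ := hA
  by_contra hc
  push Not at hc
  have h1 := hmax (insert x A) (Set.subset_insert _ _)
    (Set.insert_subset hx hAF) (by
      rintro u (rfl | hu) v (rfl | hv) huv
      · exact absurd rfl huv
      · exact hc v hv
      · rw [dist_comm]; exact hc u hu
      · exact hsep u hu v hv huv)
  have h2 : x ∈ A := h1 ▸ Set.mem_insert x A
  have h3 := hc x h2
  rw [dist_self] at h3
  linarith

lemma maxSep_finite {E : Type*} [PseudoMetricSpace E] {F A : Set E} {ε : ℝ} (hε : 0 < ε)
    (hF : TotallyBounded F) (hA : IsMaxSeparated F A ε) : A.Finite := by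
  obtain ⟨hAF, hsep, -⟩ := hA
  obtain ⟨t, ht, hcov⟩ := Metric.totallyBounded_iff.1 hF (ε / 2) (by positivity)
  have h1 : ∀ x ∈ A, ∃ y ∈ t, dist x y < ε / 2 := by
    intro x hx
    simpa using hcov (hAF hx)
  choose! φ hφ1 hφ2 using h1
  refine Set.Finite.of_injOn (f := φ) (t := t) (fun x hx => hφ1 x hx) ?_ ht
  intro x hx y hy hxy
  by_contra hne
  have h2 := hsep x hx y hy hne
  have h3 := hφ2 x hx
  have h4 := hφ2 y hy
  rw [← hxy] at h4
  have := dist_triangle_right x y (φ x)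
  linarith

lemma level_step {H : Type*} [NormedAddCommGroup H] [InnerProductSpace ℝ H]
    {Ω : Type*} [MeasurableSpace Ω] {μ : Measure Ω} [IsProbabilityMeasure μ]
    {W : H → Ω → ℝ} (hW : IsIsonormal μ W)
    (A : Set H) (hA : A.Finite) (i : ℕ) (T : Finset H) (hT : ∀ x ∈ T, x ∈ A)
    (hsep : ∀ x ∈ A, ∀ y ∈ A, x ≠ y → (2 : ℝ) ^ (-(i : ℤ) - 1) ≤ dist x y)
    (hdiam : ∀ x ∈ T, ∀ y ∈ T, dist x y ≤ 8 * (2 : ℝ) ^ (-(i : ℤ) - 1)) :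
    Real.sqrt (Real.log T.card) ≤
      66 * ((2 : ℝ) ^ i * modulus μ W A ((2 : ℝ) ^ (2 - (i : ℤ)))) := by
  have h8 : (2 : ℝ) ^ (2 - (i : ℤ)) = 8 * (2 : ℝ) ^ (-(i : ℤ) - 1) := by
    have : (2 - (i : ℤ)) = 3 + (-(i : ℤ) - 1) := by ring
    rw [this, zpow_add₀ (by norm_num)]
    norm_num
  have h2i : (2 : ℝ) ^ i * (2 : ℝ) ^ (-(i : ℤ) - 1) = 1 / 2 := by
    rw [← zpow_natCast, ← zpow_add₀ (by norm_num),
      show ((i : ℤ) + (-(i : ℤ) - 1)) = -1 by ring]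
    norm_num
  have key := sudakov_local hW A hA ((2 : ℝ) ^ (-(i : ℤ) - 1)) (by positivity)
    (fun j => (T.equivFin.symm j : H)) (fun j => hT _ (T.equivFin.symm j).2)
    (fun j l hjl => by
      rw [← dist_eq_norm]
      refine hsep _ (hT _ (T.equivFin.symm j).2) _ (hT _ (T.equivFin.symm l).2) ?_
      intro he
      exact hjl (T.equivFin.symm.injective (Subtype.ext he)))
    (fun j l => by
      rw [← dist_eq_norm]
      exact hdiam _ (T.equivFin.symm j).2 _ (T.equivFin.symm l).2)
  rw [← h8] at key
  have h3 := mul_le_mul_of_nonneg_left key (by positivity : (0 : ℝ) ≤ 2 ^ i)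
  rw [← mul_assoc, h2i] at h3
  linarith

lemma coveringNum_le {E : Type*} [PseudoMetricSpace E] {F A : Set E} {ε δ : ℝ} (hε : 0 < ε)
    (hδ : ε ≤ δ) (hA : IsMaxSeparated F A ε) (hAf : A.Finite) :
    coveringNum F δ ≤ hAf.toFinset.card := by
  apply Nat.sInf_le
  refine ⟨hAf.toFinset, by simpa using hA.1, rfl, ?_⟩
  intro x hx
  obtain ⟨y, hy, hd⟩ := maxSep_net hε hA x hx
  simp only [Set.mem_iUnion]
  exact ⟨y, by simpa using hy, by rw [Metric.mem_closedBall]; linarith⟩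

/-- For a totally bounded class `F` of diameter `1` in a separable
Hilbert space carrying an isonormal Gaussian process, and maximal `2^{-i-1}`-separated
subsets `A i` of `F`, there is a universal constant `K` with
`H(F, 2^{-k})^{1/2} ≤ K ∑_{i=0}^{k} 2^i ω(A i, 2^{2-i})` for every `k ≥ 0`. -/
theorem sqrt_entropy_le_sum_modulus_separated :
    ∃ K : ℝ, 0 < K ∧
      ∀ (H : Type) [NormedAddCommGroup H] [InnerProductSpace ℝ H] [CompleteSpace H]
        [TopologicalSpace.SeparableSpace H]
        (Ω : Type) [MeasurableSpace Ω] (μ : Measure Ω) [IsProbabilityMeasure μ]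
        (W : H → Ω → ℝ), IsIsonormal μ W →
        ∀ F : Set H, TotallyBounded F → Metric.diam F = 1 →
          ∀ A : ℕ → Set H, (∀ i : ℕ, IsMaxSeparated F (A i) ((2 : ℝ) ^ (-(i : ℤ) - 1))) →
            ∀ k : ℕ,
              Real.sqrt (entropy F ((2 : ℝ) ^ (-(k : ℤ)))) ≤
                K * ∑ i ∈ Finset.range (k + 1),
                  (2 : ℝ) ^ i * modulus μ W (A i) ((2 : ℝ) ^ (2 - (i : ℤ))) := by
  refine ⟨66, by norm_num, ?_⟩
  intro H _ _ _ _ Ω _ μ _ W hW F hF hd A hA k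
  have hpos : ∀ i : ℕ, (0 : ℝ) < (2 : ℝ) ^ (-(i : ℤ) - 1) := fun i => by positivity
  have hfin : ∀ i, (A i).Finite := fun i => maxSep_finite (hpos i) hF (hA i)
  have hFne : F.Nonempty := by
    by_contra hc
    rw [Set.not_nonempty_iff_eq_empty] at hc
    rw [hc, Metric.diam_empty] at hd
    norm_num at hd
  have hAne : ∀ i, (hfin i).toFinset.Nonempty := by
    intro i
    obtain ⟨x, hx⟩ := hFne
    obtain ⟨y, hy, -⟩ := maxSep_net (hpos i) (hA i) x hx
    exact ⟨y, by simpa using hy⟩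
  have main : ∀ k : ℕ, Real.sqrt (Real.log (hfin k).toFinset.card) ≤
      66 * ∑ i ∈ Finset.range (k + 1),
        (2 : ℝ) ^ i * modulus μ W (A i) ((2 : ℝ) ^ (2 - (i : ℤ))) := by
    intro k
    induction k with
    | zero =>
      rw [Finset.sum_range_succ, Finset.sum_range_zero, zero_add]
      refine level_step hW (A 0) (hfin 0) 0 _ (fun x hx => by simpa using hx) (hA 0).2.1 ?_
      intro x hx y hy
      have h1 := Metric.dist_le_diam_of_mem hF.isBounded
        ((hA 0).1 ((hfin 0).mem_toFinset.1 hx)) ((hA 0).1 ((hfin 0).mem_toFinset.1 hy))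
      rw [hd] at h1
      norm_num
      linarith
    | succ k ih =>
      classical
      rw [Finset.sum_range_succ, mul_add]
      have h1 : ∀ x ∈ F, ∃ y ∈ A k, dist x y < (2 : ℝ) ^ (-(k : ℤ) - 1) :=
        fun x hx => maxSep_net (hpos k) (hA k) x hx
      choose! φ hφ1 hφ2 using h1
      set s := (hfin (k + 1)).toFinset with hs
      have hsA : ∀ x ∈ s, x ∈ A (k + 1) := fun x hx => by simpa [hs] using hx
      have hsF : ∀ x ∈ s, x ∈ F := fun x hx => (hA (k + 1)).1 (hsA x hx)
      obtain ⟨z, hz, hzmax⟩ := Finset.exists_max_image (hfin k).toFinset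
        (fun z => (s.filter (fun x => φ x = z)).card) (hAne k)
      have hcard := Finset.card_le_mul_card_image_of_maps_to (s := s) (t := (hfin k).toFinset)
        (f := φ) (fun x hx => by simpa using hφ1 x (hsF x hx)) _ hzmax
      set T := s.filter (fun x => φ x = z) with hT
      have hstep := level_step hW (A (k + 1)) (hfin (k + 1)) (k + 1) T
        (fun x hx => hsA x (Finset.mem_filter.1 hx).1) (hA (k + 1)).2.1 (by
          intro x hx y hy
          obtain ⟨hx1, hx2⟩ := Finset.mem_filter.1 hx
          obtain ⟨hy1, hy2⟩ := Finset.mem_filter.1 hy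
          have h3 := hφ2 x (hsF x hx1)
          have h4 := hφ2 y (hsF y hy1)
          rw [hx2] at h3
          rw [hy2] at h4
          have h5 := dist_triangle_right x y z
          have h6 : (2 : ℝ) ^ (-(k : ℤ) - 1) = 2 * (2 : ℝ) ^ (-((k + 1 : ℕ) : ℤ) - 1) := by
            have : (-(k : ℤ) - 1) = 1 + (-((k + 1 : ℕ) : ℤ) - 1) := by push_cast; ring
            rw [this, zpow_add₀ (by norm_num)]
            norm_num
          have h7 := hpos (k + 1)
          linarith)
      have hs0 : 0 < s.card := (hAne (k + 1)).card_pos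
      have hk0 : 0 < (hfin k).toFinset.card := (hAne k).card_pos
      have hT0 : 0 < T.card := by
        rcases Nat.eq_zero_or_pos T.card with h0 | h0
        · rw [h0] at hcard; omega
        · exact h0
      have hlog : Real.log s.card ≤ Real.log T.card + Real.log (hfin k).toFinset.card := by
        rw [← Real.log_mul (by positivity) (by positivity)]
        apply Real.log_le_log (by positivity)
        exact_mod_cast hcard
      have h9 := Real.sqrt_le_sqrt hlog
      have h10 : Real.sqrt (Real.log T.card + Real.log (hfin k).toFinset.card) ≤
          Real.sqrt (Real.log T.card) + Real.sqrt (Real.log (hfin k).toFinset.card) := by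
        have ha := Real.log_natCast_nonneg T.card
        have hb := Real.log_natCast_nonneg (hfin k).toFinset.card
        apply Real.sqrt_le_iff.2
        refine ⟨by positivity, ?_⟩
        rw [add_sq, Real.sq_sqrt ha, Real.sq_sqrt hb]
        have : 0 ≤ 2 * Real.sqrt (Real.log T.card) *
          Real.sqrt (Real.log (hfin k).toFinset.card) := by positivity
        linarith
      linarith
  refine le_trans (Real.sqrt_le_sqrt ?_) (main k)
  have hc := coveringNum_le (δ := (2 : ℝ) ^ (-(k : ℤ))) (hpos k)
    (zpow_le_zpow_right₀ (by norm_num) (by linarith)) (hA k) (hfin k)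
  rw [entropy]
  rcases Nat.eq_zero_or_pos (coveringNum F ((2 : ℝ) ^ (-(k : ℤ)))) with h0 | h0
  · rw [h0]
    simpa using Real.log_natCast_nonneg (hfin k).toFinset.card
  · exact Real.log_le_log (by positivity) (by exact_mod_cast hc)
end
end

section
/- Let 𝓕 be a totally bounded subset of a Hilbert space and δ > 0, and let 𝓕^{δ/4} be a maximal (δ/4)-separated subset of 𝓕. Then the local entropies satisfy H(𝓕, δ, δ/2) ≤ H(𝓕^{δ/4}, 3δ/2, δ/8), i.e. sup_{f∈𝓕} log N(B(f,δ) ∩ 𝓕, δ/2) ≤ sup_{f∈𝓕^{δ/4}} log N(B(f, 3δ/2) ∩ 𝓕^{δ/4}, δ/8). -/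
open Set

noncomputable section

/-- The local `ε`-entropy of `F` at scale `δ`: `H(F, δ, ε) = sup_{f ∈ F} H(B(f,δ) ∩ F, ε)`. -/
def locEntropy {E : Type*} [PseudoMetricSpace E] (F : Set E) (δ ε : ℝ) : ℝ :=
  sSup {a : ℝ | ∃ f ∈ F, a = entropy (Metric.closedBall f δ ∩ F) ε}

/-- For a totally bounded subset `F` of a Hilbert space and a maximal
`(δ/4)`-separated subset `A` of `F`, the local entropies satisfy
`H(F, δ, δ/2) ≤ H(A, 3δ/2, δ/8)`. -/
theorem locEntropy_le_locEntropy_separated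
    {E : Type*} [NormedAddCommGroup E] [InnerProductSpace ℝ E]
    (F : Set E) (hF : TotallyBounded F)
    (δ : ℝ) (hδ : 0 < δ) (A : Set E) (hA : IsMaxSeparated F A (δ / 4)) :
    locEntropy F δ (δ / 2) ≤ locEntropy A (3 * δ / 2) (δ / 8) := by
  classical
  obtain ⟨hAF, hsep, hmax⟩ := hA
  -- `A` is a strict `δ/4`-net of `F`
  have hnet : ∀ x ∈ F, ∃ a ∈ A, dist x a < δ / 4 := by
    intro x hx
    by_contra! hcon
    have hB := hmax (insert x A) (Set.subset_insert _ _) (Set.insert_subset hx hAF) (by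
      rintro u (rfl | hu) v (rfl | hv) huv
      · exact absurd rfl huv
      · exact hcon v hv
      · rw [dist_comm]; exact hcon u hu
      · exact hsep u hu v hv huv)
    have hxA : x ∈ A := hB ▸ Set.mem_insert x A
    have := hcon x hxA
    rw [dist_self] at this
    linarith
  -- points of `A` within `δ/4` coincide
  have heq : ∀ x ∈ A, ∀ y ∈ A, dist x y < δ / 4 → x = y := by
    intro x hx y hy h
    by_contra hne
    exact absurd (hsep x hx y hy hne) (not_le.mpr h)
  have hAfin : A.Finite := by
    obtain ⟨t, ht, hcov⟩ := Metric.totallyBounded_iff.mp (hF.subset hAF) (δ / 8) (by linarith)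
    have hc : ∀ x : E, ∃ c, x ∈ A → c ∈ t ∧ dist x c < δ / 8 := by
      intro x
      by_cases hx : x ∈ A
      · have h := hcov hx
        simp only [Set.mem_iUnion, Metric.mem_ball, exists_prop] at h
        obtain ⟨c, h1, h2⟩ := h
        exact ⟨c, fun _ => ⟨h1, h2⟩⟩
      · exact ⟨x, fun h => absurd h hx⟩
    choose c hc using hc
    refine Set.Finite.of_injOn (f := c) (fun x hx => (hc x hx).1) ?_ ht
    intro x hx y hy hxy
    apply heq x hx y hy
    have h1 := (hc x hx).2
    have h2 := (hc y hy).2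
    rw [← hxy] at h2
    have := dist_triangle_right x y (c x)
    linarith
  have hcovS : ∀ a, coveringNum (Metric.closedBall a (3 * δ / 2) ∩ A) (δ / 8)
      = (Metric.closedBall a (3 * δ / 2) ∩ A).ncard := by
    intro a
    have hSfin : (Metric.closedBall a (3 * δ / 2) ∩ A).Finite := hAfin.inter_of_right _
    have : {n : ℕ | ∃ s : Finset E, ↑s ⊆ (Metric.closedBall a (3 * δ / 2) ∩ A) ∧ s.card = n ∧
        (Metric.closedBall a (3 * δ / 2) ∩ A) ⊆ ⋃ c ∈ s, Metric.closedBall c (δ / 8)}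
        = {(Metric.closedBall a (3 * δ / 2) ∩ A).ncard} := by
      ext n
      simp only [Set.mem_ofPred_eq, Set.mem_singleton_iff]
      constructor
      · rintro ⟨s, hs, rfl, hcov⟩
        have : (s : Set E) = Metric.closedBall a (3 * δ / 2) ∩ A := by
          refine Set.Subset.antisymm hs fun x hx => ?_
          have h := hcov hx
          simp only [Set.mem_iUnion, Metric.mem_closedBall, exists_prop] at h
          obtain ⟨c, h1, h2⟩ := h
          rw [heq x hx.2 c (hs h1).2 (by linarith)]
          exact h1
        rw [← this, Set.ncard_coe_finset]
      · rintro rfl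
        refine ⟨hSfin.toFinset, by simp, (Set.ncard_eq_toFinset_card _ hSfin).symm, ?_⟩
        intro x hx
        simp only [Set.mem_iUnion, exists_prop]
        exact ⟨x, by simpa using hx, Metric.mem_closedBall_self (by linarith)⟩
    rw [coveringNum, this, csInf_singleton]
  have hlog : ∀ m n : ℕ, m ≤ n → Real.log m ≤ Real.log n := by
    intro m n h
    rcases Nat.eq_zero_or_pos m with rfl | hm
    · simpa using Real.log_natCast_nonneg n
    · exact Real.log_le_log (by exact_mod_cast hm) (by exact_mod_cast h)
  have hbdd : BddAbove {b : ℝ | ∃ f ∈ A,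
      b = entropy (Metric.closedBall f (3 * δ / 2) ∩ A) (δ / 8)} := by
    refine ⟨Real.log A.ncard, ?_⟩
    rintro b ⟨f, _, rfl⟩
    rw [entropy, hcovS]
    exact hlog _ _ (Set.ncard_le_ncard Set.inter_subset_right hAfin)
  unfold locEntropy
  refine Real.sSup_le ?_ (Real.sSup_nonneg ?_)
  · rintro b ⟨f, hf, rfl⟩
    obtain ⟨a, haA, hfa⟩ := hnet f hf
    refine le_trans ?_ (le_csSup hbdd ⟨a, haA, rfl⟩)
    rw [entropy, entropy, hcovS]
    apply hlog
    have hpi : ∀ x : E, ∃ y, x ∈ F → y ∈ A ∧ dist x y < δ / 4 := by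
      intro x
      by_cases hx : x ∈ F
      · obtain ⟨y, h1, h2⟩ := hnet x hx
        exact ⟨y, fun _ => ⟨h1, h2⟩⟩
      · exact ⟨x, fun h => absurd h hx⟩
    choose p hp using hpi
    have hsub : Set.image p (Metric.closedBall f δ ∩ F) ⊆ Metric.closedBall a (3 * δ / 2) ∩ A := by
      rintro _ ⟨x, ⟨hxf, hxF⟩, rfl⟩
      obtain ⟨h1, h2⟩ := hp x hxF
      refine ⟨?_, h1⟩
      rw [Metric.mem_closedBall] at hxf ⊢
      have t1 := dist_triangle (p x) x a
      have t2 := dist_triangle x f a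
      rw [dist_comm (p x) x] at t1
      linarith
    have hSfin : (Metric.closedBall a (3 * δ / 2) ∩ A).Finite := hAfin.inter_of_right _
    have hTfin := hSfin.subset hsub
    have hg : ∀ t : E, ∃ x, t ∈ Set.image p (Metric.closedBall f δ ∩ F) →
        x ∈ Metric.closedBall f δ ∩ F ∧ p x = t := by
      intro t
      by_cases ht : t ∈ Set.image p (Metric.closedBall f δ ∩ F)
      · obtain ⟨x, h1, h2⟩ := ht
        exact ⟨x, fun _ => ⟨h1, h2⟩⟩
      · exact ⟨t, fun h => absurd h ht⟩
    choose g hg using hg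
    have hle : coveringNum (Metric.closedBall f δ ∩ F) (δ / 2)
        ≤ (hTfin.toFinset.image g).card := by
      refine Nat.sInf_le ⟨hTfin.toFinset.image g, ?_, rfl, ?_⟩
      · intro x hx
        rw [Finset.mem_coe, Finset.mem_image] at hx
        obtain ⟨t, ht, rfl⟩ := hx
        exact (hg t (hTfin.mem_toFinset.mp ht)).1
      · intro x hx
        have hpx := Set.mem_image_of_mem p hx
        simp only [Set.mem_iUnion, exists_prop]
        refine ⟨g (p x), Finset.mem_image_of_mem g (hTfin.mem_toFinset.mpr hpx), ?_⟩
        obtain ⟨h1, h2⟩ := hg (p x) hpx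
        have h3 := (hp _ h1.2).2
        rw [h2] at h3
        have h4 := (hp x hx.2).2
        rw [Metric.mem_closedBall]
        have := dist_triangle_right x (g (p x)) (p x)
        linarith
    calc _ ≤ _ := hle
      _ ≤ hTfin.toFinset.card := Finset.card_image_le
      _ = _ := (Set.ncard_eq_toFinset_card _ hTfin).symm
      _ ≤ _ := Set.ncard_le_ncard hsub hSfin
  · rintro b ⟨f, _, rfl⟩
    exact Real.log_natCast_nonneg _
end
end
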